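/- arXiv:1807.06527 — 5 statements merged into one kernel-verified Lean document; each statement's English description precedes it below -/
import Mathlib

section
/- For all positive integers b and n with n > 2b, one has 1/3 < z_{b,n} < 1/2. -/
open Finset

/-- `p b n = P(Bin(n, b/n) < b)`. -/
noncomputable def binP (b n : ℕ) : ℝ :=
  ∑ i ∈ Finset.range b, (n.choose i : ℝ) * ((b : ℝ) / n) ^ i * (1 - (b : ℝ) / n) ^ (n - i)

/-- `z b n = (1/2 - p b n) / P(Bin(n, b/n) = b)`. -/
noncomputable def binZ (b n : ℕ) : ℝ :=
  (1 / 2 - binP b n) / ((n.choose b : ℝ) * ((b : ℝ) / n) ^ b * (1 - (b : ℝ) / n) ^ (n - b))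


section aux
open Filter Topology

lemma aux_mono {f f' : ℝ → ℝ} {r l : ℝ} (hc : ContinuousOn f (Set.Ici r))
    (hd : ∀ x, r < x → HasDerivAt f (f' x) x) (hn : ∀ x, r < x → 0 ≤ f' x)
    (ht : Tendsto f atTop (𝓝 l)) : f r ≤ l := by
  have hm : MonotoneOn f (Set.Ici r) := by
    apply monotoneOn_of_deriv_nonneg (convex_Ici r) hc
    · intro x hx
      rw [interior_Ici] at hx
      exact (hd x hx).differentiableAt.differentiableWithinAt
    · intro x hx
      rw [interior_Ici] at hx
      rw [(hd x hx).deriv]; exact hn x hx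
  apply ge_of_tendsto ht
  filter_upwards [eventually_ge_atTop r] with x hx
  exact hm Set.self_mem_Ici hx hx

lemma aux_strict {f f' : ℝ → ℝ} {r l : ℝ} (hc : ContinuousOn f (Set.Ici r))
    (hd : ∀ x, r < x → HasDerivAt f (f' x) x) (hn : ∀ x, r < x → 0 < f' x)
    (ht : Tendsto f atTop (𝓝 l)) : f r < l := by
  have hm : StrictMonoOn f (Set.Ici r) := by
    apply strictMonoOn_of_deriv_pos (convex_Ici r) hc
    intro x hx
    rw [interior_Ici] at hx
    rw [(hd x hx).deriv]; exact hn x hx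
  have h1 : f r < f (r + 1) := hm Set.self_mem_Ici (by simp) (by linarith)
  have h2 : f (r + 1) ≤ l := aux_mono (f' := f') (hc.mono (Set.Ici_subset_Ici.2 (by linarith)))
    (fun x hx => hd x (by linarith)) (fun x hx => (hn x (by linarith)).le) ht
  linarith

/-- The auxiliary function. -/
noncomputable def auxV (S G : ℝ → ℝ) (p q x : ℝ) : ℝ :=
  S (p + x⁻¹) - p * (G p - G (p + x⁻¹)) + p * q * (x * (G p - G (p + x⁻¹)))

lemma auxV_deriv {S G : ℝ → ℝ} {p q N x : ℝ} (hpq : p + q = 1) 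
    (hS : ∀ t, 0 < t → t < 1 → HasDerivAt S (-(N * p * G t / t)) t)
    (hG : ∀ t, 0 < t → t < 1 → HasDerivAt G (N * (p - t) * G t / (t * (1 - t))) t)
    (hx : x ≠ 0) (h0 : 0 < p + x⁻¹) (h1 : p + x⁻¹ < 1) :
    HasDerivAt (auxV S G p q) (p * q * (G p - G (p + x⁻¹))) x := by
  have ht : HasDerivAt (fun x : ℝ => p + x⁻¹) (-(x ^ 2)⁻¹) x := (hasDerivAt_inv hx).const_add p
  have dS := HasDerivAt.comp x (hS _ h0 h1) ht
  have dG := HasDerivAt.comp x (hG _ h0 h1) ht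
  have d2 := (dG.const_sub (G p))
  have := (dS.sub (d2.const_mul p)).add (((hasDerivAt_id x).mul d2).const_mul (p * q))
  refine HasDerivAt.congr_deriv this ?_
  simp only [Function.comp, id]
  set g := G (p + x⁻¹)
  have e : x⁻¹ = (p + x⁻¹) - p := by ring
  have h0' := h0.ne'
  have h1' : 1 - (p + x⁻¹) ≠ 0 := by linarith
  generalize hy : p + x⁻¹ = t at *
  have hxe : x = (t - p)⁻¹ := by rw [← e, inv_inv]
  have htp : t - p ≠ 0 := by rw [← e]; exact inv_ne_zero hx
  obtain rfl : q = 1 - p := by linarith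
  subst hxe
  field_simp
  ring

lemma auxV_tendsto {S G : ℝ → ℝ} {p q : ℝ} {l : Filter ℝ} {u : ℝ → ℝ} (hSc : Continuous S)
    (hGc : Continuous G) (hGd : HasDerivAt G 0 p) (hu : Tendsto (fun x => (u x)⁻¹) l (𝓝[≠] 0)) :
    Tendsto (fun x => auxV S G p q (u x)) l (𝓝 (S p)) := by
  have hu0 : Tendsto (fun x => (u x)⁻¹) l (𝓝 0) := hu.mono_right nhdsWithin_le_nhds
  have ht : Tendsto (fun x => p + (u x)⁻¹) l (𝓝 p) := by simpa using hu0.const_add p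
  have h1 := (hSc.tendsto p).comp ht
  have h2 := (hGc.tendsto p).comp ht
  have h3 := (hasDerivAt_iff_tendsto_slope_zero.1 hGd).comp hu
  have := (h1.sub ((h2.const_sub (G p)).const_mul p)).sub (h3.const_mul (p * q))
  refine (this.congr ?_).trans (by simp)
  intro x
  simp only [Function.comp, auxV, inv_inv, smul_eq_mul]
  ring

lemma log_tendsto {G : ℝ → ℝ} {p : ℝ} {l : Filter ℝ} {u : ℝ → ℝ}
    (hGc : Continuous G) (hp : 0 < G p) (hu : Tendsto (fun x => (u x)⁻¹) l (𝓝[≠] 0)) :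
    Tendsto (fun x => Real.log (G (p + (u x)⁻¹))) l (𝓝 (Real.log (G p))) := by
  have hu0 : Tendsto (fun x => (u x)⁻¹) l (𝓝 0) := hu.mono_right nhdsWithin_le_nhds
  have ht : Tendsto (fun x => p + (u x)⁻¹) l (𝓝 p) := by simpa using hu0.const_add p
  have h2 := (hGc.tendsto p).comp ht
  exact h2.log hp.ne'

lemma log_deriv {G : ℝ → ℝ} {p q N x : ℝ} (hpq : p + q = 1)
    (hG : ∀ t, 0 < t → t < 1 → HasDerivAt G (N * (p - t) * G t / (t * (1 - t))) t)
    (hpos : ∀ t, 0 < t → t < 1 → 0 < G t)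
    (hx : x ≠ 0) (h0 : 0 < p + x⁻¹) (h1 : p + x⁻¹ < 1) :
    HasDerivAt (fun x => Real.log (G (p + x⁻¹))) (N / (x * ((p * x + 1) * (q * x - 1)))) x := by
  have ht : HasDerivAt (fun x : ℝ => p + x⁻¹) (-(x ^ 2)⁻¹) x := (hasDerivAt_inv hx).const_add p
  have dG := HasDerivAt.comp x (hG _ h0 h1) ht
  have hg := hpos _ h0 h1
  have := dG.log hg.ne'
  refine HasDerivAt.congr_deriv this ?_
  simp only [Function.comp]
  set g := G (p + x⁻¹)
  have h0' := h0.ne'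
  have h1' : 1 - (p + x⁻¹) ≠ 0 := by linarith
  have e1 : p * x + 1 = x * (p + x⁻¹) := by field_simp
  have e2 : q * x - 1 = x * (1 - (p + x⁻¹)) := by
    obtain rfl : q = 1 - p := by linarith
    field_simp; ring
  have e : p - (p + x⁻¹) = - x⁻¹ := by ring
  rw [e1, e2, e]
  generalize p + x⁻¹ = t at *
  field_simp

lemma inv_tendsto_sub (δ : ℝ) : Tendsto (fun x : ℝ => (x - δ)⁻¹) atTop (𝓝[≠] 0) := by
  have h : Tendsto (fun x : ℝ => x - δ) atTop atTop := tendsto_atTop_add_const_right _ _ tendsto_id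
  exact (tendsto_inv_atTop_nhdsGT_zero.comp h).mono_right
    (nhdsWithin_mono _ (fun x hx => ne_of_gt hx))

lemma inv_tendsto_neg : Tendsto (fun x : ℝ => (-x)⁻¹) atTop (𝓝[≠] 0) := by
  have h : Tendsto (fun x : ℝ => -x) atTop atBot := tendsto_neg_atTop_atBot
  exact (tendsto_inv_atBot_nhdsLT_zero.comp h).mono_right
    (nhdsWithin_mono _ (fun x hx => ne_of_lt hx))

lemma range_neg {p q a : ℝ} (hp : 0 < p) (hq : 0 < q) (hpq : p + q = 1) (ha : p⁻¹ < a) :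
    0 < a ∧ -a ≠ 0 ∧ 0 < p + (-a)⁻¹ ∧ p + (-a)⁻¹ < 1 := by
  have hp' := inv_pos.2 hp
  have h : 0 < a := by linarith
  have h2 : a⁻¹ < p := inv_lt_of_inv_lt₀ hp ha
  have h3 := inv_pos.2 h
  rw [inv_neg]
  refine ⟨h, by linarith [h] |> fun (h : -a < 0) => h.ne, by linarith, by linarith⟩

lemma range_pos {p q c : ℝ} (hp : 0 < p) (hq : 0 < q) (hpq : p + q = 1) (hc : q⁻¹ < c) :
    0 < c ∧ c ≠ 0 ∧ 0 < p + c⁻¹ ∧ p + c⁻¹ < 1 := by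
  have hp' := inv_pos.2 hq
  have h : 0 < c := by linarith
  have h2 : c⁻¹ < q := inv_lt_of_inv_lt₀ hq hc
  have h3 := inv_pos.2 h
  exact ⟨h, h.ne', by linarith, by linarith⟩

lemma auxV_cont {S G : ℝ → ℝ} {p q : ℝ} {u : ℝ → ℝ} {s : Set ℝ} (hSc : Continuous S)
    (hGc : Continuous G) (hu : Continuous u) (h0 : ∀ x ∈ s, u x ≠ 0) :
    ContinuousOn (fun x => auxV S G p q (u x)) s := by
  have hi : ContinuousOn (fun x => p + (u x)⁻¹) s :=
    continuousOn_const.add (hu.continuousOn.inv₀ h0)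
  have h1 : ContinuousOn (fun x => S (p + (u x)⁻¹)) s := hSc.comp_continuousOn hi
  have h2 : ContinuousOn (fun x => G (p + (u x)⁻¹)) s := hGc.comp_continuousOn hi
  have hu' := hu.continuousOn (s := s)
  unfold auxV
  fun_prop

lemma core {S G : ℝ → ℝ} {p q N : ℝ} (hpq : p + q = 1) (hp : 0 < p) (hlt : p < q) (hN : 0 < N)
    (hSc : Continuous S) (hGc : Continuous G)
    (hS : ∀ t, 0 < t → t < 1 → HasDerivAt S (-(N * p * G t / t)) t)
    (hG : ∀ t, 0 < t → t < 1 → HasDerivAt G (N * (p - t) * G t / (t * (1 - t))) t)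
    (hpos : ∀ t, 0 < t → t < 1 → 0 < G t)
    (S0 : S 0 = 1) (S1 : S 1 = 0) (G0 : G 0 = 0) (G1 : G 1 = 0) :
    2 / 3 * G p < 1 - 2 * S p ∧ 1 - 2 * S p < G p := by
  have hq : 0 < q := by linarith
  have hp1 : p < 1 := by linarith
  have hGp : 0 < G p := hpos p hp hp1
  have hGd : HasDerivAt G 0 p := by simpa using hG p hp hp1
  have hp' : 0 < p⁻¹ := inv_pos.2 hp
  have hq' : 0 < q⁻¹ := inv_pos.2 hq
  have hinv : q⁻¹ < p⁻¹ := by gcongr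
  have hd1 : ∀ δ a : ℝ, p⁻¹ < a → q⁻¹ < a - δ → HasDerivAt
      (fun a => Real.log (G (p + (-a)⁻¹)) - Real.log (G (p + (a - δ)⁻¹)))
      (N / (a * ((p * a - 1) * (q * a + 1))) -
        N / ((a - δ) * ((p * (a - δ) + 1) * (q * (a - δ) - 1)))) a := by
    intro δ a ha hc
    obtain ⟨a0, a1, a2, a3⟩ := range_neg hp hq hpq ha
    obtain ⟨c0, c1, c2, c3⟩ := range_pos hp hq hpq hc
    have d1 := HasDerivAt.comp a (log_deriv hpq hG hpos a1 a2 a3) (hasDerivAt_neg a)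
    have d2 := HasDerivAt.comp a (log_deriv hpq hG hpos c1 c2 c3) ((hasDerivAt_id a).sub_const δ)
    refine (d1.sub d2).congr_deriv ?_
    congr 1
    · rw [mul_neg_one, ← div_neg]; congr 1; ring
    · rw [mul_one]; rfl
  have hlim : ∀ δ : ℝ, Tendsto
      (fun a => Real.log (G (p + (-a)⁻¹)) - Real.log (G (p + (a - δ)⁻¹))) atTop (𝓝 0) := by
    intro δ
    simpa using (log_tendsto hGc hGp inv_tendsto_neg).sub (log_tendsto hGc hGp (inv_tendsto_sub δ))
  have hWd : ∀ δ a : ℝ, p⁻¹ < a → q⁻¹ < a - δ → HasDerivAt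
      (fun a => auxV S G p q (-a) + auxV S G p q (a - δ))
      (p * q * (G (p + (-a)⁻¹) - G (p + (a - δ)⁻¹))) a := by
    intro δ a ha hc
    obtain ⟨a0, a1, a2, a3⟩ := range_neg hp hq hpq ha
    obtain ⟨c0, c1, c2, c3⟩ := range_pos hp hq hpq hc
    have d1 := HasDerivAt.comp a (auxV_deriv (q := q) hpq hS hG a1 a2 a3) (hasDerivAt_neg a)
    have d2 := HasDerivAt.comp a (auxV_deriv (q := q) hpq hS hG c1 c2 c3)
      ((hasDerivAt_id a).sub_const δ)
    refine (d1.add d2).congr_deriv ?_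
    simp only [id]
    ring
  have hWlim : ∀ δ : ℝ, Tendsto
      (fun a => auxV S G p q (-a) + auxV S G p q (a - δ)) atTop (𝓝 (S p + S p)) := by
    intro δ
    exact (auxV_tendsto hSc hGc hGd inv_tendsto_neg).add
      (auxV_tendsto hSc hGc hGd (inv_tendsto_sub δ))
  have hWc : ∀ δ : ℝ, q⁻¹ ≤ p⁻¹ - δ → ContinuousOn
      (fun a => auxV S G p q (-a) + auxV S G p q (a - δ)) (Set.Ici p⁻¹) := by
    intro δ h
    refine (auxV_cont hSc hGc continuous_neg ?_).add
      (auxV_cont hSc hGc (continuous_id.sub continuous_const) ?_)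
    · intro x hx
      have : p⁻¹ ≤ x := hx
      exact (by linarith : -x < 0).ne
    · intro x hx
      have : p⁻¹ ≤ x := hx
      exact (by simp only [id]; linarith : 0 < id x - δ).ne'
  have hVm : auxV S G p q (-p⁻¹) = 1 - p * G p - q * G p := by
    simp only [auxV, inv_neg, inv_inv, add_neg_cancel, S0, G0]
    field_simp; ring
  have hVp : auxV S G p q q⁻¹ = 0 := by
    simp only [auxV, inv_inv, hpq, S1, G1]
    field_simp; ring
  constructor
  · -- lower bound
    set δ : ℝ := 2 / 3 * (p⁻¹ - q⁻¹) with hδ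
    have hδ0 : 0 < δ := by rw [hδ]; linarith
    have hle : q⁻¹ < p⁻¹ - δ := by rw [hδ]; linarith
    have key : ∀ a, p⁻¹ < a → G (p + (-a)⁻¹) ≤ G (p + (a - δ)⁻¹) := by
      intro a ha
      obtain ⟨a0, a1, a2, a3⟩ := range_neg hp hq hpq ha
      obtain ⟨c0, c1, c2, c3⟩ := range_pos hp hq hpq (by linarith : q⁻¹ < a - δ)
      have := aux_mono (r := a) (fun x (hx : a ≤ x) => (hd1 δ x (by linarith) (by linarith)).continuousAt.continuousWithinAt)
        (fun x hx => hd1 δ x (by linarith) (by linarith)) ?_ (hlim δ)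
      · rw [← Real.log_le_log_iff (hpos _ a2 a3) (hpos _ c2 c3)]
        linarith
      · intro x hx
        have hx1 : p⁻¹ < x := by linarith
        have hxp : 0 < p * x - 1 := by
          have := mul_lt_mul_of_pos_left hx1 hp
          rw [mul_inv_cancel₀ hp.ne'] at this; linarith
        have hx0 : 0 < x := by linarith
        have hA : 0 < x * ((p * x - 1) * (q * x + 1)) := by positivity
        have hB : x * ((p * x - 1) * (q * x + 1)) ≤
            (x - δ) * ((p * (x - δ) + 1) * (q * (x - δ) - 1)) := by
          have e : (q - p) = 3 / 2 * (p * q * δ) := by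
            rw [hδ]; field_simp
          have : (x - δ) * ((p * (x - δ) + 1) * (q * (x - δ) - 1)) -
            x * ((p * x - 1) * (q * x + 1)) = δ * (1 + (q - p) * δ / 3) := by
            have : (x - δ) * ((p * (x - δ) + 1) * (q * (x - δ) - 1)) -
              x * ((p * x - 1) * (q * x + 1)) = p * q * ((x - δ)^3 - x^3) + (q - p) * ((x-δ)^2+x^2)
                + δ := by ring
            rw [this, e]; ring
          have h2 : 0 ≤ δ * (1 + (q - p) * δ / 3) := by
            have : 0 < q - p := by linarith
            positivity
          linarith
        rw [sub_nonneg]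
        gcongr
    have hW := aux_mono (f := fun a => -(auxV S G p q (-a) + auxV S G p q (a - δ)))
      (r := p⁻¹) (hWc δ hle.le).neg
      (fun x hx => (hWd δ x hx (by linarith)).neg) (fun x hx => by
        have := key x hx
        have h2 : 0 ≤ p * q * (G (p + (x - δ)⁻¹) - G (p + (-x)⁻¹)) :=
          mul_nonneg (by positivity) (by linarith)
        linarith) (hWlim δ).neg
    have hV2 : auxV S G p q (p⁻¹ - δ) ≤ p * q * G p * (p⁻¹ - δ - q⁻¹) := by
      have hm : AntitoneOn (fun c => auxV S G p q c - p * q * G p * c) (Set.Ici q⁻¹) := by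
        have hd : ∀ x, q⁻¹ < x → HasDerivAt (fun c => auxV S G p q c - p * q * G p * c)
            (p * q * (G p - G (p + x⁻¹)) - p * q * G p * 1) x := by
          intro x hx
          obtain ⟨c0, c1, c2, c3⟩ := range_pos hp hq hpq hx
          exact (auxV_deriv (q := q) hpq hS hG c1 c2 c3).sub ((hasDerivAt_id x).const_mul _)
        apply antitoneOn_of_deriv_nonpos (convex_Ici _)
        · refine (auxV_cont (u := fun x => x) hSc hGc continuous_id ?_).sub (by fun_prop)
          intro x hx
          have : q⁻¹ ≤ x := hx
          exact (by linarith : 0 < x).ne'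
        · intro x hx
          rw [interior_Ici] at hx
          exact (hd x hx).differentiableAt.differentiableWithinAt
        · intro x hx
          rw [interior_Ici] at hx
          rw [(hd x hx).deriv]
          obtain ⟨c0, c1, c2, c3⟩ := range_pos hp hq hpq hx
          have : 0 < p * q * G (p + x⁻¹) := by have := hpos _ c2 c3; positivity
          linarith
      have := hm Set.self_mem_Ici (Set.mem_Ici.2 hle.le) hle.le
      simp only [hVp] at this
      linarith
    have e : p * q * G p * (p⁻¹ - δ - q⁻¹) = (q - p) / 3 * G p := by
      rw [hδ]; field_simp; ring
    simp only [hVm] at hW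
    have : 0 < p * G p := by positivity
    obtain rfl : q = 1 - p := by linarith
    linarith
  · set δ : ℝ := p⁻¹ - q⁻¹ with hδ
    have hδ0 : 0 < δ := by rw [hδ]; linarith
    have key : ∀ a, p⁻¹ < a → G (p + (a - δ)⁻¹) < G (p + (-a)⁻¹) := by
      intro a ha
      obtain ⟨a0, a1, a2, a3⟩ := range_neg hp hq hpq ha
      obtain ⟨c0, c1, c2, c3⟩ := range_pos hp hq hpq (by linarith : q⁻¹ < a - δ)
      have := aux_strict (r := a) (fun x (hx : a ≤ x) => (hd1 δ x (by linarith) (by linarith)).neg.continuousAt.continuousWithinAt)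
        (fun x hx => (hd1 δ x (by linarith) (by linarith)).neg) ?_ (hlim δ).neg
      · rw [← Real.log_lt_log_iff (hpos _ c2 c3) (hpos _ a2 a3)]
        simp only [Pi.neg_apply] at this
        linarith
      · intro x hx
        have hx1 : p⁻¹ < x := by linarith
        have hxp : 0 < p * x - 1 := by
          have := mul_lt_mul_of_pos_left hx1 hp
          rw [mul_inv_cancel₀ hp.ne'] at this; linarith
        have hx0 : 0 < x := by linarith
        have hc0 : 0 < x - δ := by linarith
        have hB : (p * (x - δ) + 1) * (q * (x - δ) - 1) = (p * x - 1) * (q * x + 1) := by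
          rw [hδ]; field_simp; ring
        rw [hB, neg_sub, sub_pos]
        have : x - δ < x := by linarith
        gcongr
    have hW := aux_strict (r := p⁻¹) (hWc δ (by linarith))
      (fun x hx => (hWd δ x hx (by linarith))) (fun x hx => 
        mul_pos (by positivity) (by linarith [key x hx])) (hWlim δ)
    have e : p⁻¹ - δ = q⁻¹ := by rw [hδ]; ring
    simp only [hVm, e, hVp] at hW
    obtain rfl : q = 1 - p := by linarith
    linarith

lemma term_deriv (n i : ℕ) (t : ℝ) :
    HasDerivAt (fun t : ℝ => (n.choose i : ℝ) * t ^ i * (1 - t) ^ (n - i))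
      (i * n.choose i * t ^ (i - 1) * (1 - t) ^ (n - i) -
        ((n - i : ℕ) : ℝ) * n.choose i * t ^ i * (1 - t) ^ (n - i - 1)) t := by
  have h1 := (hasDerivAt_pow i t).const_mul (n.choose i : ℝ)
  have h2 := ((hasDerivAt_id t).const_sub 1).pow (n - i)
  refine (h1.mul h2).congr_deriv ?_
  simp only [id, Pi.pow_apply]
  ring

lemma sum_deriv (n b : ℕ) (t : ℝ) :
    HasDerivAt (fun t : ℝ => ∑ i ∈ Finset.range b, (n.choose i : ℝ) * t ^ i * (1 - t) ^ (n - i))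
      (-(b * n.choose b * t ^ (b - 1) * (1 - t) ^ (n - b))) t := by
  induction b with
  | zero => simpa using hasDerivAt_const t (0 : ℝ)
  | succ b ih =>
    simp only [Finset.sum_range_succ]
    refine (ih.add (term_deriv n b t)).congr_deriv ?_
    have h : ((n.choose (b + 1) : ℝ)) * ((b + 1 : ℕ) : ℝ) = n.choose b * ((n - b : ℕ) : ℝ) := by
      exact_mod_cast Nat.choose_succ_right_eq n b
    rw [Nat.add_sub_cancel, ← Nat.sub_sub, mul_comm ((b + 1 : ℕ) : ℝ), h]
    ring

end aux

theorem z_between_third_and_half (b n : ℕ) (hb : 0 < b) (hn : 2 * b < n) :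
    1 / 3 < binZ b n ∧ binZ b n < 1 / 2 := by
  have hbR : (0 : ℝ) < b := by exact_mod_cast hb
  have hnR : (2 : ℝ) * b < n := by exact_mod_cast hn
  have hn0 : (0 : ℝ) < n := by linarith
  have hcast : ((n - b : ℕ) : ℝ) = n - b := by rw [Nat.cast_sub (by omega)]
  have hch : (0 : ℝ) < n.choose b := by exact_mod_cast Nat.choose_pos (by omega)
  have hnp : (n : ℝ) * (b / n) = b := by field_simp
  have hp : (0 : ℝ) < b / n := by positivity
  have hp2 : (b : ℝ) / n < 1 / 2 := by rw [div_lt_div_iff₀ hn0 (by norm_num)]; linarith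
  have hpos : ∀ t : ℝ, 0 < t → t < 1 → 0 < (n.choose b : ℝ) * t ^ b * (1 - t) ^ (n - b) := by
    intro t h0 h1
    have : 0 < 1 - t := by linarith
    positivity
  have := core (S := fun t : ℝ => ∑ i ∈ Finset.range b, (n.choose i : ℝ) * t ^ i * (1 - t) ^ (n - i))
    (G := fun t : ℝ => (n.choose b : ℝ) * t ^ b * (1 - t) ^ (n - b)) (p := (b : ℝ) / n)
    (q := 1 - (b : ℝ) / n) (N := n) (by ring) hp (by linarith) hn0 (by fun_prop) (by fun_prop)
    ?_ ?_ hpos ?_ ?_ ?_ ?_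
  · have hg := hpos _ hp (by linarith)
    unfold binZ binP
    obtain ⟨h1, h2⟩ := this
    rw [lt_div_iff₀ hg, div_lt_iff₀ hg]
    constructor <;> linarith
  · intro t h0 h1
    refine (sum_deriv n b t).congr_deriv ?_
    rw [hnp]
    obtain ⟨k, rfl⟩ : ∃ k, b = k + 1 := ⟨b - 1, by omega⟩
    rw [Nat.add_sub_cancel, pow_succ]
    field_simp
  · intro t h0 h1
    refine (term_deriv n b t).congr_deriv ?_
    have h1' : 1 - t ≠ 0 := by linarith
    have e : (n : ℝ) * (b / n - t) = b * (1 - t) - (n - b) * t := by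
      rw [mul_sub, hnp]; ring
    rw [e, ← hcast]
    obtain ⟨k, rfl⟩ : ∃ k, b = k + 1 := ⟨b - 1, by omega⟩
    obtain ⟨m, hm⟩ : ∃ m, n - (k + 1) = m + 1 := ⟨n - (k + 1) - 1, by omega⟩
    rw [hm, Nat.add_sub_cancel, Nat.add_sub_cancel, pow_succ, pow_succ]
    field_simp
  · obtain ⟨k, rfl⟩ : ∃ k, b = k + 1 := ⟨b - 1, by omega⟩
    simp [Finset.sum_range_succ']
  · apply Finset.sum_eq_zero
    intro i hi
    have := Finset.mem_range.1 hi
    have : n - i ≠ 0 := by omega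
    simp [this]
  · simp [hb.ne']
  · have : n - b ≠ 0 := by omega
    simp [this]
end

section
/- For all positive integers b and n with b < n < 2b, one has 1/2 < z_{b,n} < 2/3. -/
open Finset

open Filter Topology

lemma aux_lim (F F' : ℝ → ℝ) (w0 l : ℝ) (hd : ∀ w, w0 ≤ w → HasDerivAt F (F' w) w)
    (hn : ∀ w, w0 < w → F' w < 0) (ht : Tendsto F atTop (𝓝 l)) : l < F w0 := by
  have hs : StrictAntiOn F (Set.Ici w0) := by
    apply strictAntiOn_of_deriv_neg (convex_Ici w0)
    · intro w hw
      exact (hd w hw).continuousAt.continuousWithinAt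
    · intro w hw
      rw [interior_Ici] at hw
      rw [(hd w (le_of_lt hw)).deriv]
      exact hn w hw
  have h1 : F (w0 + 1) < F w0 := hs (by simp) (by simp) (by linarith)
  have h2 : l ≤ F (w0 + 1) := by
    apply le_of_tendsto ht
    filter_upwards [eventually_ge_atTop (w0 + 1)] with w hw
    exact hs.antitoneOn (by simp) (by simp; linarith) hw
  linarith

lemma aux_slope (g : ℝ → ℝ) (p σ : ℝ) (hg : HasDerivAt g 0 p) :
    Tendsto (fun v : ℝ => v * (g (p + σ * v⁻¹) - g p)) atTop (𝓝 0) := by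
  have h0 : HasDerivAt (fun s : ℝ => g (p + σ * s)) (0 * σ) 0 := by
    have h1 : HasDerivAt (fun s : ℝ => p + σ * s) σ 0 := by
      simpa using ((hasDerivAt_id (0:ℝ)).const_mul σ).const_add p
    have h2 : HasDerivAt g 0 (p + σ * 0) := by simpa using hg
    exact HasDerivAt.comp (0:ℝ) h2 h1
  have h3 := h0.tendsto_slope_zero_right
  have h4 := h3.comp tendsto_inv_atTop_nhdsGT_zero
  simpa [Function.comp_def] using h4

lemma aux_inv (p σ : ℝ) : Tendsto (fun v : ℝ => p + σ * v⁻¹) atTop (𝓝 p) := by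
  simpa using (tendsto_inv_atTop_zero.const_mul σ).const_add p

lemma aux_dinv (p σ v : ℝ) (hv : 0 < v) :
    HasDerivAt (fun v : ℝ => p + σ * v⁻¹) (-σ / v ^ 2) v := by
  refine (((hasDerivAt_inv hv.ne').const_mul σ).const_add p).congr_deriv ?_
  ring

/-- the log-likelihood -/
noncomputable def auxG (p q u : ℝ) : ℝ := p * Real.log (p + u) + q * Real.log (q - u)

lemma auxG_d (p q σ v : ℝ) (hv : 0 < v) (h1 : 0 < p + σ * v⁻¹) (h2 : 0 < q - σ * v⁻¹) :
    HasDerivAt (fun v => auxG p q (0 + σ * v⁻¹))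
      ((p / (p + σ * v⁻¹) - q / (q - σ * v⁻¹)) * (-σ / v ^ 2)) v := by
  have hG : HasDerivAt (auxG p q) (p / (p + σ * v⁻¹) - q / (q - σ * v⁻¹)) (0 + σ * v⁻¹) := by
    unfold auxG
    rw [zero_add]
    have a1 : HasDerivAt (fun u : ℝ => p + u) 1 (σ * v⁻¹) := (hasDerivAt_id _).const_add p
    have a2 : HasDerivAt (fun u : ℝ => q - u) (-1) (σ * v⁻¹) := (hasDerivAt_id _).const_sub q
    refine (((a1.log h1.ne').const_mul p).add ((a2.log h2.ne').const_mul q)).congr_deriv ?_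
    ring
  exact hG.comp v (aux_dinv 0 σ v hv)

lemma auxG_lim (p q σ c : ℝ) (hp : 0 < p) (hq : 0 < q) :
    Tendsto (fun w => auxG p q (0 + σ * (w + c)⁻¹)) atTop (𝓝 (auxG p q 0)) := by
  have hc : ContinuousAt (auxG p q) 0 := by
    unfold auxG
    have h1 : p + 0 ≠ 0 := by simpa using hp.ne'
    have h2 : q - 0 ≠ 0 := by simpa using hq.ne'
    fun_prop (disch := assumption)
  exact hc.tendsto.comp ((aux_inv 0 σ).comp (tendsto_atTop_add_const_right _ c tendsto_id))

/-- first comparison -/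
lemma auxG_case1 (p q w : ℝ) (hq : 0 < q) (hpq : q < p) (h1 : p + q = 1) (hw : 0 < w) :
    auxG p q (0 + (-1) * (w + 1 / p)⁻¹) < auxG p q (0 + 1 * (w + 1 / q)⁻¹) := by
  have hp : 0 < p := by linarith
  have key := aux_lim
    (fun w => auxG p q (0 + 1 * (w + 1 / q)⁻¹) - auxG p q (0 + (-1) * (w + 1 / p)⁻¹))
    (fun w => (p / (p + 1 * (w + 1 / q)⁻¹) - q / (q - 1 * (w + 1 / q)⁻¹)) * (-1 / (w + 1 / q) ^ 2)
      - (p / (p + (-1) * (w + 1 / p)⁻¹) - q / (q - (-1) * (w + 1 / p)⁻¹)) *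
        (-(-1) / (w + 1 / p) ^ 2)) w 0 ?_ ?_ ?_
  · linarith
  · intro x hx
    have hx0 : 0 < x := by linarith
    have e1 : (x + 1 / q)⁻¹ < q := by
      rw [inv_lt_comm₀ (by positivity) hq, inv_eq_one_div]; linarith
    have e2 : (x + 1 / p)⁻¹ < p := by
      rw [inv_lt_comm₀ (by positivity) hp, inv_eq_one_div]; linarith
    have e3 : 0 < (x + 1 / q)⁻¹ := by positivity
    have e4 : 0 < (x + 1 / p)⁻¹ := by positivity
    exact ((auxG_d p q 1 (x + 1 / q) (by positivity) (by linarith) (by linarith)).comp_add_const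
      x (1 / q)).sub ((auxG_d p q (-1) (x + 1 / p) (by positivity) (by linarith)
        (by linarith)).comp_add_const x (1 / p))
  · intro x hx
    have hx0 : 0 < x := by linarith
    have E1 : (p / (p + 1 * (x + 1 / q)⁻¹) - q / (q - 1 * (x + 1 / q)⁻¹)) * (-1 / (x + 1 / q) ^ 2)
        = q / (x * (q * x + 1) * (p * q * x + 1)) := by
      have a1 : p + 1 * (x + 1 / q)⁻¹ = (p * q * x + 1) / (q * x + 1) := by
        field_simp; linear_combination h1
      have a2 : q - 1 * (x + 1 / q)⁻¹ = q * (q * x) / (q * x + 1) := by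
        field_simp; ring
      rw [a1, a2]
      have : q * x + 1 ≠ 0 := by positivity
      have : p * q * x + 1 ≠ 0 := by positivity
      field_simp
      ring
    have E2 : (p / (p + (-1) * (x + 1 / p)⁻¹) - q / (q - (-1) * (x + 1 / p)⁻¹)) *
        (-(-1) / (x + 1 / p) ^ 2) = p / (x * (p * x + 1) * (p * q * x + 1)) := by
      have a1 : q - (-1) * (x + 1 / p)⁻¹ = (p * q * x + 1) / (p * x + 1) := by
        field_simp; linear_combination h1
      have a2 : p + (-1) * (x + 1 / p)⁻¹ = p * (p * x) / (p * x + 1) := by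
        field_simp; ring
      rw [a1, a2]
      have : p * x + 1 ≠ 0 := by positivity
      have : p * q * x + 1 ≠ 0 := by positivity
      field_simp
      ring
    simp only [E1, E2]
    rw [sub_neg, div_lt_div_iff₀ (by positivity) (by positivity)]
    have : 0 < x * (p * q * x + 1) * (p - q) := by
      have : 0 < p - q := by linarith
      positivity
    nlinarith
  · simpa using (auxG_lim p q 1 (1 / q) hp hq).sub (auxG_lim p q (-1) (1 / p) hp hq)

/-- second comparison -/
lemma auxG_case2 (p q w a : ℝ) (hq : 0 < q) (hpq : q < p) (h1 : p + q = 1)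
    (ha : 3 * p * q * a = p - q) (hw : 1 / q - a < w) :
    auxG p q (0 + 1 * (w + a)⁻¹) < auxG p q (0 + (-1) * (w + -a)⁻¹) := by
  have hp : 0 < p := by linarith
  have ha0 : 0 < a := by
    by_contra h
    have : 0 ≤ 3 * p * q * (-a) := by
      have : 0 ≤ -a := by linarith
      positivity
    linarith
  have hqp : 1 / q - 1 / p = 3 * a := by
    field_simp
    linarith
  have hp1 : 0 < 1 / p := by positivity
  have key := aux_lim
    (fun w => auxG p q (0 + (-1) * (w + -a)⁻¹) - auxG p q (0 + 1 * (w + a)⁻¹))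
    (fun w => (p / (p + (-1) * (w + -a)⁻¹) - q / (q - (-1) * (w + -a)⁻¹)) *
        (-(-1) / (w + -a) ^ 2)
      - (p / (p + 1 * (w + a)⁻¹) - q / (q - 1 * (w + a)⁻¹)) * (-1 / (w + a) ^ 2)) w 0 ?_ ?_ ?_
  · linarith
  · intro x hx
    have e5 : 0 < x + a := by linarith
    have e6 : 0 < x + -a := by linarith
    have e1 : (x + a)⁻¹ < q := by
      rw [inv_lt_comm₀ (by positivity) hq, inv_eq_one_div]; linarith
    have e2 : (x + -a)⁻¹ < p := by
      rw [inv_lt_comm₀ (by positivity) hp, inv_eq_one_div]; linarith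
    have e3 : 0 < (x + a)⁻¹ := by positivity
    have e4 : 0 < (x + -a)⁻¹ := by positivity
    exact ((auxG_d p q (-1) (x + -a) (by positivity) (by linarith)
        (by linarith)).comp_add_const x (-a)).sub
        ((auxG_d p q 1 (x + a) (by positivity) (by linarith) (by linarith)).comp_add_const x a)
  · intro x hx
    obtain ⟨v, hv⟩ : ∃ v, v = x + a := ⟨_, rfl⟩
    obtain ⟨V, hV⟩ : ∃ V, V = x + -a := ⟨_, rfl⟩
    have e5 : 0 < v := by linarith
    have e6 : 0 < V := by linarith
    have e7 : 0 < q * v - 1 := by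
      have : q * (1 / q) < q * v := by
        apply mul_lt_mul_of_pos_left _ hq; linarith
      rw [mul_one_div_cancel hq.ne'] at this; linarith
    have e8 : 0 < p * V - 1 := by
      have : p * (1 / p) < p * V := by
        apply mul_lt_mul_of_pos_left _ hp; linarith
      rw [mul_one_div_cancel hp.ne'] at this; linarith
    have E1 : (p / (p + 1 * v⁻¹) - q / (q - 1 * v⁻¹)) * (-1 / v ^ 2)
        = 1 / (v * (p * v + 1) * (q * v - 1)) := by
      have a1 : p + 1 * v⁻¹ = (p * v + 1) / v := by field_simp
      have a2 : q - 1 * v⁻¹ = (q * v - 1) / v := by field_simp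
      rw [a1, a2]
      have : p * v + 1 ≠ 0 := by positivity
      have h7 := e7.ne'
      rw [div_div_eq_mul_div, div_div_eq_mul_div, div_sub_div _ _ this h7, div_mul_div_comm,
        div_eq_div_iff (by positivity) (by positivity)]
      linear_combination (v ^ 2 * (p * v + 1) * (q * v - 1)) * h1
    have E2 : (p / (p + (-1) * V⁻¹) - q / (q - (-1) * V⁻¹)) * (-(-1) / V ^ 2)
        = 1 / (V * (p * V - 1) * (q * V + 1)) := by
      have a1 : p + (-1) * V⁻¹ = (p * V - 1) / V := by field_simp; ring
      have a2 : q - (-1) * V⁻¹ = (q * V + 1) / V := by field_simp; ring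
      rw [a1, a2]
      have : q * V + 1 ≠ 0 := by positivity
      have h8 := e8.ne'
      rw [div_div_eq_mul_div, div_div_eq_mul_div, div_sub_div _ _ h8 this, div_mul_div_comm,
        div_eq_div_iff (by positivity) (by positivity)]
      linear_combination (V ^ 2 * (p * V - 1) * (q * V + 1)) * h1
    simp only [← hv, ← hV, E1, E2]
    rw [sub_neg]
    apply one_div_lt_one_div_of_lt (by positivity)
    have hid : V * (p * V - 1) * (q * V + 1) - v * (p * v + 1) * (q * v - 1)
        = 4 * p * q * a ^ 3 + 2 * a := by
      rw [hv, hV]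
      linear_combination (-2 * (x ^ 2 + a ^ 2)) * ha
    have : 0 < 4 * p * q * a ^ 3 + 2 * a := by positivity
    linarith
  · simpa using (auxG_lim p q (-1) (-a) hp hq).sub (auxG_lim p q 1 a hp hq)

/-- the likelihood -/
noncomputable def auxg (C : ℝ) (k m : ℕ) (t : ℝ) : ℝ := C * t ^ (k + 1) * (1 - t) ^ (m + 1)

lemma auxg_d (C : ℝ) (k m : ℕ) (t : ℝ) :
    HasDerivAt (auxg C k m) (C * t ^ k * (1 - t) ^ m * ((k + 1) * (1 - t) - (m + 1) * t)) t := by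
  unfold auxg
  have a1 : HasDerivAt (fun t : ℝ => 1 - t) (-1) t := (hasDerivAt_id _).const_sub 1
  refine (((hasDerivAt_pow (k + 1) t).const_mul C).mul (a1.pow (m + 1))).congr_deriv ?_
  simp only [Pi.pow_apply, Nat.add_sub_cancel]
  push_cast
  ring

lemma auxg_exp (C p q u : ℝ) (k m : ℕ) (h1 : p + q = 1)
    (hk : (k : ℝ) + 1 = (k + m + 2) * p) (hm : (m : ℝ) + 1 = (k + m + 2) * q)
    (ha : 0 < p + u) (hb : 0 < q - u) :
    auxg C k m (p + u) = C * Real.exp ((k + m + 2) * auxG p q u) := by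
  have e : 1 - (p + u) = q - u := by linarith
  unfold auxg auxG
  rw [e, mul_add, Real.exp_add, ← mul_assoc, ← mul_assoc, ← mul_assoc, ← hk, ← hm]
  have h2 : ∀ (j : ℕ) (x : ℝ), 0 < x → Real.exp (((j : ℝ) + 1) * Real.log x) = x ^ (j + 1) := by
    intro j x hx
    have := Real.exp_nat_mul (Real.log x) (j + 1)
    rw [Real.exp_log hx] at this
    push_cast at this
    exact this
  rw [h2 _ _ ha, h2 _ _ hb]

section
variable (A : ℝ → ℝ) (C p q : ℝ) (k m : ℕ)

/-- left function -/
noncomputable def auxL (v : ℝ) : ℝ :=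
  (1 - A (p + (-1) * v⁻¹) - auxg C k m (p + (-1) * v⁻¹))
    - (p * q * v - q) * auxg C k m (p + (-1) * v⁻¹)

/-- right function -/
noncomputable def auxR (v : ℝ) : ℝ :=
  A (p + 1 * v⁻¹) - (p * q * v - p) * auxg C k m (p + 1 * v⁻¹)

lemma auxL_d (hA : ∀ t, HasDerivAt A (-((k + 1) * C * t ^ k * (1 - t) ^ (m + 1))) t)
    (h1 : p + q = 1)
    (hk : (k : ℝ) + 1 = (k + m + 2) * p) (hm : (m : ℝ) + 1 = (k + m + 2) * q)
    (v : ℝ) (hv : 0 < v) :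
    HasDerivAt (auxL A C p q k m) (-(p * q * auxg C k m (p + (-1) * v⁻¹))) v := by
  unfold auxL
  have d1 := aux_dinv p (-1) v hv
  have dA := (hA (p + (-1) * v⁻¹)).comp v d1
  have dg := (auxg_d C k m (p + (-1) * v⁻¹)).comp v d1
  have dl : HasDerivAt (fun v : ℝ => p * q * v - q) (p * q) v := by
    simpa using ((hasDerivAt_id v).const_mul (p * q)).sub_const q
  have := ((dA.const_sub 1).sub dg).sub (dl.mul dg)
  refine this.congr_deriv ?_
  simp only [Function.comp]
  obtain ⟨t, ht⟩ : ∃ t, t = p + (-1) * v⁻¹ := ⟨_, rfl⟩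
  have hvt : v * p = v * t + 1 := by rw [ht]; field_simp; ring
  rw [← ht]
  unfold auxg
  rw [hk, hm]
  obtain ⟨N, hN⟩ : ∃ N : ℝ, N = k + m + 2 := ⟨_, rfl⟩
  rw [← hN]
  have hq' : q = 1 - p := by linarith
  subst hq'
  have hp' : p = t + v⁻¹ := by rw [ht]; ring
  subst hp'
  field_simp
  ring

lemma auxR_d (hA : ∀ t, HasDerivAt A (-((k + 1) * C * t ^ k * (1 - t) ^ (m + 1))) t)
    (h1 : p + q = 1)
    (hk : (k : ℝ) + 1 = (k + m + 2) * p) (hm : (m : ℝ) + 1 = (k + m + 2) * q)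
    (v : ℝ) (hv : 0 < v) :
    HasDerivAt (auxR A C p q k m) (-(p * q * auxg C k m (p + 1 * v⁻¹))) v := by
  unfold auxR
  have d1 := aux_dinv p 1 v hv
  have dA := (hA (p + 1 * v⁻¹)).comp v d1
  have dg := (auxg_d C k m (p + 1 * v⁻¹)).comp v d1
  have dl : HasDerivAt (fun v : ℝ => p * q * v - p) (p * q) v := by
    simpa using ((hasDerivAt_id v).const_mul (p * q)).sub_const p
  have := dA.sub (dl.mul dg)
  refine this.congr_deriv ?_
  simp only [Function.comp]
  obtain ⟨t, ht⟩ : ∃ t, t = p + 1 * v⁻¹ := ⟨_, rfl⟩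
  rw [← ht]
  unfold auxg
  rw [hk, hm]
  obtain ⟨N, hN⟩ : ∃ N : ℝ, N = k + m + 2 := ⟨_, rfl⟩
  rw [← hN]
  have hq' : q = 1 - p := by linarith
  subst hq'
  have hp' : p = t - v⁻¹ := by rw [ht]; ring
  subst hp'
  field_simp
  ring

lemma auxg_d0 (h1 : p + q = 1)
    (hk : (k : ℝ) + 1 = (k + m + 2) * p) (hm : (m : ℝ) + 1 = (k + m + 2) * q) :
    HasDerivAt (auxg C k m) 0 p := by
  refine (auxg_d C k m p).congr_deriv ?_
  have : ((k + 1) * (1 - p) - (m + 1) * p : ℝ) = 0 := by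
    rw [hk, hm]
    have : 1 - p = q := by linarith
    rw [this]; ring
  rw [this, mul_zero]

lemma auxH_lim (hA : ∀ t, HasDerivAt A (-((k + 1) * C * t ^ k * (1 - t) ^ (m + 1))) t)
    (h1 : p + q = 1)
    (hk : (k : ℝ) + 1 = (k + m + 2) * p) (hm : (m : ℝ) + 1 = (k + m + 2) * q) (α β : ℝ) :
    Tendsto (fun w => auxL A C p q k m (w + α) - auxR A C p q k m (w + β)) atTop
      (𝓝 (1 - A p - auxg C k m p - A p - (p - q) * auxg C k m p
        - p * q * (α - β) * auxg C k m p)) := by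
  have hg := auxg_d0 C p q k m h1 hk hm
  have tg : ∀ σ : ℝ, Tendsto (fun v : ℝ => auxg C k m (p + σ * v⁻¹)) atTop (𝓝 (auxg C k m p)) :=
    fun σ => hg.continuousAt.tendsto.comp (aux_inv p σ)
  have tA : ∀ σ : ℝ, Tendsto (fun v : ℝ => A (p + σ * v⁻¹)) atTop (𝓝 (A p)) :=
    fun σ => (hA p).continuousAt.tendsto.comp (aux_inv p σ)
  have hL : Tendsto (fun v => auxL A C p q k m v + p * q * v * auxg C k m p) atTop
      (𝓝 (1 - A p - auxg C k m p - p * q * 0 + q * auxg C k m p)) := by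
    have := ((((tA (-1)).const_sub 1).sub (tg (-1))).sub
      ((aux_slope _ p (-1) hg).const_mul (p * q))).add ((tg (-1)).const_mul q)
    refine this.congr ?_
    intro v
    unfold auxL
    ring
  have hR : Tendsto (fun v => auxR A C p q k m v + p * q * v * auxg C k m p) atTop
      (𝓝 (A p - p * q * 0 + p * auxg C k m p)) := by
    have := ((tA 1).sub
      ((aux_slope _ p 1 hg).const_mul (p * q))).add ((tg 1).const_mul p)
    refine this.congr ?_
    intro v
    unfold auxR
    ring
  have hL' := hL.comp (tendsto_atTop_add_const_right _ α tendsto_id)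
  have hR' := hR.comp (tendsto_atTop_add_const_right _ β tendsto_id)
  have := (hL'.sub hR').sub_const (p * q * (α - β) * auxg C k m p)
  refine (this.congr ?_).trans (le_of_eq ?_)
  · intro w
    simp only [Function.comp, id]
    ring
  · congr 1
    ring

lemma aux_main (hC : 0 < C)
    (hA : ∀ t, HasDerivAt A (-((k + 1) * C * t ^ k * (1 - t) ^ (m + 1))) t)
    (hA0 : A 0 = 1) (hA1 : A 1 = 0)
    (h1 : p + q = 1) (hq : 0 < q) (hpq : q < p)
    (hk : (k : ℝ) + 1 = (k + m + 2) * p) (hm : (m : ℝ) + 1 = (k + m + 2) * q) :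
    0 < 1 - A p - auxg C k m p - A p ∧
      1 - A p - auxg C k m p - A p < (p - q) / 3 * auxg C k m p := by
  have hp : 0 < p := by linarith
  have hN : (0 : ℝ) < k + m + 2 := by positivity
  have L0 : auxL A C p q k m (1 / p) = 0 := by
    have : p + (-1) * (1 / p)⁻¹ = 0 := by simp
    unfold auxL
    rw [this, hA0]
    simp [auxg]
  have R0 : auxR A C p q k m (1 / q) = 0 := by
    have : p + 1 * (1 / q)⁻¹ = 1 := by simp [h1]
    unfold auxR
    rw [this, hA1]
    simp [auxg]
  have gpos : ∀ t, 0 < t → t < 1 → 0 < auxg C k m t := by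
    intro t h0 h1
    have : 0 < 1 - t := by linarith
    unfold auxg; positivity
  constructor
  · have key := aux_lim
      (fun w => -(auxL A C p q k m (w + 1 / p) - auxR A C p q k m (w + 1 / q)))
      (fun w => -(-(p * q * auxg C k m (p + (-1) * (w + 1 / p)⁻¹))
        - -(p * q * auxg C k m (p + 1 * (w + 1 / q)⁻¹)))) 0 _ ?_ ?_
      (auxH_lim A C p q k m hA h1 hk hm (1 / p) (1 / q)).neg
    · simp only [zero_add, L0, R0] at key
      have : p * q * (1 / p - 1 / q) = q - p := by field_simp
      rw [this] at key
      linarith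
    · intro x hx
      exact (((auxL_d A C p q k m hA h1 hk hm (x + 1 / p) (by positivity)).comp_add_const
        x (1 / p)).sub ((auxR_d A C p q k m hA h1 hk hm (x + 1 / q)
          (by positivity)).comp_add_const x (1 / q))).neg
    · intro x hx
      have e1 : (x + 1 / q)⁻¹ < q := by
        rw [inv_lt_comm₀ (by positivity) hq, inv_eq_one_div]; linarith
      have e2 : (x + 1 / p)⁻¹ < p := by
        rw [inv_lt_comm₀ (by positivity) hp, inv_eq_one_div]; linarith
      have e3 : 0 < (x + 1 / q)⁻¹ := by positivity
      have e4 : 0 < (x + 1 / p)⁻¹ := by positivity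
      have c := auxG_case1 p q x hq hpq h1 hx
      rw [zero_add, zero_add] at c
      have : auxg C k m (p + (-1) * (x + 1 / p)⁻¹) < auxg C k m (p + 1 * (x + 1 / q)⁻¹) := by
        rw [auxg_exp C p q _ k m h1 hk hm (by linarith) (by linarith),
          auxg_exp C p q _ k m h1 hk hm (by linarith) (by linarith)]
        gcongr
      have := mul_lt_mul_of_pos_left this (mul_pos hp hq)
      linarith
  · obtain ⟨a, ha⟩ : ∃ a : ℝ, 3 * p * q * a = p - q := ⟨(p - q) / (3 * p * q), by field_simp⟩
    have ha0 : 0 < a := by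
      by_contra h
      have : 0 ≤ 3 * p * q * (-a) := by
        have : 0 ≤ -a := by linarith
        positivity
      linarith
    have hqp : 1 / q - 1 / p = 3 * a := by
      field_simp
      linarith
    have hp1 : 0 < 1 / p := by positivity
    have key := aux_lim
      (fun w => (auxL A C p q k m (w + -a) - auxR A C p q k m (w + a)))
      (fun w => (-(p * q * auxg C k m (p + (-1) * (w + -a)⁻¹))
        - -(p * q * auxg C k m (p + 1 * (w + a)⁻¹)))) (1 / q - a) _ ?_ ?_
      (auxH_lim A C p q k m hA h1 hk hm (-a) a)
    · have hL : auxL A C p q k m (1 / q - a + -a) ≤ 0 := by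
        rw [← L0]
        have hanti : AntitoneOn (auxL A C p q k m) (Set.Ici (1 / p)) := by
          apply antitoneOn_of_deriv_nonpos (convex_Ici _)
          · intro v hv
            exact (auxL_d A C p q k m hA h1 hk hm v
              (lt_of_lt_of_le hp1 hv)).continuousAt.continuousWithinAt
          · intro v hv
            rw [interior_Ici] at hv
            exact (auxL_d A C p q k m hA h1 hk hm v
              (lt_trans hp1 hv)).differentiableAt.differentiableWithinAt
          · intro v hv
            rw [interior_Ici] at hv
            have hv' : 1 / p < v := hv
            have hv0 : 0 < v := lt_trans hp1 hv'
            rw [(auxL_d A C p q k m hA h1 hk hm v hv0).deriv]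
            have e2 : v⁻¹ < p := by
              rw [inv_lt_comm₀ (by positivity) hp, inv_eq_one_div]; linarith
            have e4 : 0 < v⁻¹ := by positivity
            have := gpos (p + (-1) * v⁻¹) (by linarith) (by linarith)
            have : 0 < p * q * auxg C k m (p + (-1) * v⁻¹) := by positivity
            linarith
        apply hanti (by simp) _ (by linarith)
        simp only [Set.mem_Ici]; linarith
      have hR : 1 / q - a + a = 1 / q := by ring
      simp only [hR, R0] at key
      have : p * q * (-a - a) = -(2 / 3) * (p - q) := by linear_combination (-2 / 3) * ha
      rw [this] at key
      linarith
    · intro x hx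
      exact (((auxL_d A C p q k m hA h1 hk hm (x + -a) (by linarith)).comp_add_const
        x (-a)).sub ((auxR_d A C p q k m hA h1 hk hm (x + a)
          (by linarith)).comp_add_const x a))
    · intro x hx
      have e5 : 0 < x + a := by linarith
      have e6 : 0 < x + -a := by linarith
      have e1 : (x + a)⁻¹ < q := by
        rw [inv_lt_comm₀ (by positivity) hq, inv_eq_one_div]; linarith
      have e2 : (x + -a)⁻¹ < p := by
        rw [inv_lt_comm₀ (by positivity) hp, inv_eq_one_div]; linarith
      have e3 : 0 < (x + a)⁻¹ := by positivity
      have e4 : 0 < (x + -a)⁻¹ := by positivity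
      have c := auxG_case2 p q x a hq hpq h1 ha hx
      rw [zero_add, zero_add] at c
      have : auxg C k m (p + 1 * (x + a)⁻¹) < auxg C k m (p + (-1) * (x + -a)⁻¹) := by
        rw [auxg_exp C p q _ k m h1 hk hm (by linarith) (by linarith),
          auxg_exp C p q _ k m h1 hk hm (by linarith) (by linarith)]
        gcongr
      have := mul_lt_mul_of_pos_left this (mul_pos hp hq)
      linarith
end

lemma auxA_d (n k : ℕ) (hk : k + 1 ≤ n) (t : ℝ) :
    HasDerivAt (fun t : ℝ => ∑ i ∈ Finset.range (k + 1), (n.choose i : ℝ) * t ^ i * (1 - t) ^ (n - i))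
      (-((k + 1) * (n.choose (k + 1) : ℝ) * t ^ k * (1 - t) ^ (n - (k + 1)))) t := by
  have a1 : HasDerivAt (fun t : ℝ => 1 - t) (-1) t := (hasDerivAt_id _).const_sub 1
  induction k with
  | zero =>
    obtain ⟨j, rfl⟩ : ∃ j, n = j + 1 := ⟨n - 1, by omega⟩
    refine ((a1.pow (j + 1)).congr_of_eventuallyEq (Eventually.of_forall ?_)).congr_deriv ?_
    · intro x; simp
    · simp
  | succ k ih =>
    have ih' := ih (by omega)
    obtain ⟨j, rfl⟩ : ∃ j, n = k + 2 + j := ⟨n - (k + 2), by omega⟩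
    have e1 : k + 2 + j - (k + 1) = j + 1 := by omega
    have e2 : k + 2 + j - (k + 1 + 1) = j := by omega
    have d := ((hasDerivAt_pow (k + 1) t).const_mul ((k + 2 + j).choose (k + 1) : ℝ)).mul
      (a1.pow (j + 1))
    have hc : ((k + 2 + j).choose (k + 1 + 1) : ℝ) * (k + 1 + 1)
        = ((k + 2 + j).choose (k + 1) : ℝ) * (j + 1) := by
      have := Nat.choose_succ_right_eq (k + 2 + j) (k + 1)
      rw [e1] at this
      exact_mod_cast this
    rw [e1] at ih'
    rw [e2]
    have s := ih'.add d
    refine (s.congr_of_eventuallyEq (Eventually.of_forall ?_)).congr_deriv ?_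
    · intro x
      simp only [Pi.add_apply, Pi.mul_apply, Pi.pow_apply]
      rw [Finset.sum_range_succ _ (k + 1), e1]
    · simp only [Pi.pow_apply, Nat.add_sub_cancel]
      push_cast
      linear_combination (t ^ (k + 1) * (1 - t) ^ j) * hc

theorem z_between_half_and_two_thirds (b n : ℕ) (hb : 0 < b) (hbn : b < n) (hn : n < 2 * b) :
    1 / 2 < binZ b n ∧ binZ b n < 2 / 3 := by
  obtain ⟨k, rfl⟩ : ∃ k, b = k + 1 := ⟨b - 1, by omega⟩
  obtain ⟨m, rfl⟩ : ∃ m, n = k + m + 2 := ⟨n - (k + 2), by omega⟩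
  have e : k + m + 2 - (k + 1) = m + 1 := by omega
  have hmk : (m : ℝ) < k := by
    have : m < k := by omega
    exact_mod_cast this
  have hN : (0 : ℝ) < k + m + 2 := by positivity
  obtain ⟨p, hp⟩ : ∃ p : ℝ, p = ((k + 1 : ℕ) : ℝ) / ((k + m + 2 : ℕ) : ℝ) := ⟨_, rfl⟩
  have hpN : (k : ℝ) + 1 = (k + m + 2) * p := by
    rw [hp]; push_cast; field_simp
  have hqN : (m : ℝ) + 1 = (k + m + 2) * (1 - p) := by linarith
  have hq : 0 < 1 - p := by
    by_contra h
    have : 0 ≤ (k + m + 2 : ℝ) * (-(1 - p)) := mul_nonneg hN.le (by linarith)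
    have : (0 : ℝ) ≤ m := by positivity
    linarith
  have hqp : 1 - p < p := by
    have : (k + m + 2 : ℝ) * (1 - p) < (k + m + 2 : ℝ) * p := by linarith
    exact lt_of_mul_lt_mul_left this hN.le
  have hC : (0 : ℝ) < ((k + m + 2).choose (k + 1) : ℝ) := by
    exact_mod_cast Nat.choose_pos (by omega)
  have hA := auxA_d (k + m + 2) k (by omega)
  rw [e] at hA
  have M := aux_main _ _ p (1 - p) k m hC hA ?_ ?_ (by ring) hq hqp hpN hqN
  · unfold binZ binP
    rw [← hp, e]
    obtain ⟨M1, M2⟩ := M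
    have hg : 0 < auxg ((k + m + 2).choose (k + 1) : ℝ) k m p := by
      have : 0 < p := by linarith
      unfold auxg; positivity
    have hlt : (p - (1 - p)) / 3 * auxg ((k + m + 2).choose (k + 1) : ℝ) k m p
        < 1 / 3 * auxg ((k + m + 2).choose (k + 1) : ℝ) k m p := by
      apply mul_lt_mul_of_pos_right _ hg
      linarith
    unfold auxg at *
    constructor
    · rw [lt_div_iff₀ hg]; linarith
    · rw [div_lt_iff₀ hg]; linarith
  · rw [Finset.sum_eq_single 0]
    · simp
    · intro i _ hi; simp [hi]
    · simp
  · apply Finset.sum_eq_zero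
    intro i hi
    have := Finset.mem_range.1 hi
    have : k + m + 2 - i ≠ 0 := by omega
    simp [this]
end

section
/- For every ε > 0 there exists N such that for all integers n ≥ N and all positive integers b satisfying (1+ε)·√(77n/360) < b < n − (1+ε)·√(77n/360), one has z_{b+1,n} > z_{b,n}. -/
open Finset

/-- normalized weight -/
noncomputable def bzW (a c : ℕ) (s : ℝ) : ℝ := (1 + s / a) ^ a * (1 - s / c) ^ (c - 1)

lemma bz_log_bound (u : ℝ) (h : |u| ≤ 1 / 2) :
    |u + u ^ 2 / 2 + u ^ 3 / 3 + Real.log (1 - u)| ≤ 2 * u ^ 4 := by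
  have h1 := Real.abs_log_sub_add_sum_range_le (x := u) (by linarith) 3
  simp only [Finset.sum_range_succ, Finset.sum_range_zero] at h1
  have h2 : |u| ^ (3 + 1) / (1 - |u|) ≤ 2 * u ^ 4 := by
    rw [div_le_iff₀ (by linarith)]
    have : |u| ^ (3 + 1) = u ^ 4 := by
      rw [show 3 + 1 = 4 from rfl]; exact Even.pow_abs (by decide) u
    rw [this]
    have : 0 ≤ u ^ 4 := by positivity
    nlinarith
  refine le_trans (le_of_eq ?_) (h1.trans h2)
  congr 1
  norm_num

lemma bz_exp_bound (L l1 l2 x : ℝ) (hx0 : 0 < x) (hx : x ≤ 1 / 10)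
    (h : |L - (l1 + l2)| ≤ 5 * x ^ 3) (h1 : |l1| ≤ x) (h2 : |l2| ≤ x ^ 2) :
    |Real.exp L - (1 + l1 + l2 + l1 ^ 2 / 2)| ≤ 10 * x ^ 3 := by
  have hx2 : x ^ 2 ≤ x / 10 := by nlinarith
  have hx3 : x ^ 3 ≤ x ^ 2 / 10 := by nlinarith [sq_nonneg x]
  have hLl : |L - l1| ≤ 3 / 2 * x ^ 2 := by
    have : L - l1 = (L - (l1 + l2)) + l2 := by ring
    rw [this]
    refine (abs_add_le _ _).trans ?_
    linarith
  have hL : |L| ≤ 2 * x := by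
    have : L = (L - l1) + l1 := by ring
    rw [this]
    refine (abs_add_le _ _).trans ?_
    linarith
  have hS : |L + l1| ≤ 3 * x := (abs_add_le _ _).trans (by linarith)
  have e := Real.exp_bound (x := L) (by linarith) (n := 3) (by norm_num)
  simp only [Finset.sum_range_succ, Finset.sum_range_zero] at e
  have e2 : |L| ^ 3 * (((3 : ℕ).succ : ℝ) / ((Nat.factorial 3 : ℕ) * ((3 : ℕ) : ℝ))) ≤ 2 * x ^ 3 := by
    have : |L| ^ 3 ≤ (2 * x) ^ 3 := pow_le_pow_left₀ (abs_nonneg _) hL 3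
    have hh : (((3 : ℕ).succ : ℝ) / ((Nat.factorial 3 : ℕ) * ((3 : ℕ) : ℝ))) = 2 / 9 := by
      norm_num [Nat.factorial]
    rw [hh]
    have : 0 < x ^ 3 := by positivity
    nlinarith
  have e3 := e.trans e2
  have e4 : |(L - l1) * (L + l1) / 2| ≤ 3 * x ^ 3 := by
    rw [abs_div, abs_mul]
    have := mul_le_mul hLl hS (abs_nonneg _) (by positivity)
    rw [abs_of_pos (by norm_num : (0 : ℝ) < 2)]
    nlinarith [pow_pos hx0 3]
  norm_num [Nat.factorial] at e3
  rw [abs_le] at *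
  constructor <;> nlinarith

lemma bz_w_bound (a c : ℕ) (x y s : ℝ) (hx : x = 1 / a) (hy : y = 1 / c) (ha : 10 ≤ a)
    (hac : a ≤ c) (hs0 : 0 ≤ s) (hs1 : s ≤ 1) :
    |bzW a c s - (1 + (s * y - s ^ 2 * (x + y) / 2)
      + (s ^ 3 * (x ^ 2 - y ^ 2) / 3 + s ^ 2 * y ^ 2 / 2)
      + (s * y - s ^ 2 * (x + y) / 2) ^ 2 / 2)| ≤ 10 * x ^ 3 := by
  have ha' : (10 : ℝ) ≤ a := by exact_mod_cast ha
  have hc' : (a : ℝ) ≤ c := by exact_mod_cast hac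
  have hx0 : 0 < x := by rw [hx]; positivity
  have hc0 : (0 : ℝ) < c := by linarith
  have ha0 : (0 : ℝ) < a := by linarith
  have hy0 : 0 < y := by rw [hy]; positivity
  have hyx : y ≤ x := by rw [hx, hy]; exact one_div_le_one_div_of_le ha0 hc'
  have hx10 : x ≤ 1 / 10 := by rw [hx]; exact one_div_le_one_div_of_le (by norm_num) ha'
  have hax : a * x = 1 := by rw [hx]; field_simp
  have hcy : c * y = 1 := by rw [hy]; field_simp
  have hsx0 : 0 ≤ s * x := by positivity
  have hsx : s * x ≤ x := by nlinarith
  have hsy0 : 0 ≤ s * y := by positivity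
  have hsy : s * y ≤ y := by nlinarith
  have hw : bzW a c s = Real.exp (a * Real.log (1 - (-(s * x))) + (c - 1) * Real.log (1 - s * y)) := by
    rw [Real.exp_add]
    unfold bzW
    have e1 : (1 + s / a : ℝ) = 1 - (-(s * x)) := by rw [hx]; ring
    have e2 : (1 - s / c : ℝ) = 1 - s * y := by rw [hy]; ring
    have e3 : ((c : ℝ) - 1) = ((c - 1 : ℕ) : ℝ) := by
      rw [Nat.cast_sub (by omega)]; simp
    rw [e1, e2, e3, Real.exp_nat_mul, Real.exp_nat_mul, Real.exp_log (by linarith),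
      Real.exp_log (by linarith)]
  rw [hw]
  have hs2 : s ^ 2 ≤ 1 := pow_le_one₀ hs0 hs1
  have hs3 : s ^ 3 ≤ 1 := pow_le_one₀ hs0 hs1
  have hs4 : s ^ 4 ≤ 1 := pow_le_one₀ hs0 hs1
  have hy2 : y ^ 2 ≤ x ^ 2 := pow_le_pow_left₀ hy0.le hyx 2
  have hy3 : y ^ 3 ≤ x ^ 3 := pow_le_pow_left₀ hy0.le hyx 3
  have hyp3 : 0 < y ^ 3 := by positivity
  apply bz_exp_bound _ _ _ x hx0 hx10
  · have b1 := bz_log_bound (-(s * x)) (by rw [abs_neg, abs_of_nonneg hsx0]; linarith)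
    have b2 := bz_log_bound (s * y) (by rw [abs_of_nonneg hsy0]; linarith)
    set A := Real.log (1 - (-(s * x)))
    set B := Real.log (1 - s * y)
    set α := -(s * x) + (-(s * x)) ^ 2 / 2 + (-(s * x)) ^ 3 / 3 + A with hα
    set β := s * y + (s * y) ^ 2 / 2 + (s * y) ^ 3 / 3 + B with hβ
    have key : a * A + (c - 1) * B - ((s * y - s ^ 2 * (x + y) / 2) +
        (s ^ 3 * (x ^ 2 - y ^ 2) / 3 + s ^ 2 * y ^ 2 / 2)) = a * α + (c - 1) * β + s ^ 3 * y ^ 3 / 3 := by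
      rw [hα, hβ]
      linear_combination (s - s ^ 2 * x / 2 + s ^ 3 * x ^ 2 / 3) * hax -
        (s + s ^ 2 * y / 2 + s ^ 3 * y ^ 2 / 3) * hcy
    rw [key]
    have t1 : |a * α| ≤ 2 * x ^ 3 := by
      rw [abs_mul, abs_of_pos ha0]
      have := mul_le_mul_of_nonneg_left b1 ha0.le
      have e : a * (2 * (-(s * x)) ^ 4) = 2 * x ^ 3 * s ^ 4 := by
        linear_combination (2 * x ^ 3 * s ^ 4) * hax
      have h5 : 2 * x ^ 3 * s ^ 4 ≤ 2 * x ^ 3 := mul_le_of_le_one_right (by positivity) hs4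
      linarith
    have t2 : |(c - 1) * β| ≤ 2 * x ^ 3 := by
      rw [abs_mul, abs_of_pos (by linarith : (0 : ℝ) < c - 1)]
      have h1 : (c - 1) * |β| ≤ c * |β| := by nlinarith [abs_nonneg β]
      have := mul_le_mul_of_nonneg_left b2 hc0.le
      have e : c * (2 * (s * y) ^ 4) = 2 * y ^ 3 * s ^ 4 := by
        linear_combination (2 * y ^ 3 * s ^ 4) * hcy
      have h5 : 2 * y ^ 3 * s ^ 4 ≤ 2 * y ^ 3 := mul_le_of_le_one_right (by positivity) hs4
      linarith
    have t3 : |s ^ 3 * y ^ 3 / 3| ≤ x ^ 3 := by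
      rw [abs_of_nonneg (by positivity)]
      have h5 : s ^ 3 * y ^ 3 ≤ y ^ 3 := mul_le_of_le_one_left hyp3.le hs3
      linarith
    refine (abs_add_le _ _).trans ?_
    have := abs_add_le (a * α) ((c - 1) * β)
    linarith
  · rw [abs_le]
    constructor
    · have h5 : s ^ 2 * y ≤ s * y := by nlinarith
      have h6 : s ^ 2 * x ≤ x := mul_le_of_le_one_left hx0.le hs2
      linarith
    · have : 0 ≤ s ^ 2 * (x + y) := by positivity
      linarith
  · rw [abs_of_nonneg]
    · have : s ^ 3 * (x ^ 2 - y ^ 2) ≤ x ^ 2 - y ^ 2 :=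
        mul_le_of_le_one_left (by linarith) hs3
      have : s ^ 2 * y ^ 2 ≤ y ^ 2 := mul_le_of_le_one_left (sq_nonneg y) hs2
      linarith [sq_nonneg y, sq_nonneg x]
    · have : 0 ≤ x ^ 2 - y ^ 2 := by linarith
      positivity

lemma bz_w_le_one (a c : ℕ) (ha : 1 ≤ a) (hac : a + 1 ≤ c) : bzW a c 1 ≤ 1 := by
  obtain ⟨d, rfl⟩ : ∃ d, c = d + 1 := ⟨c - 1, by omega⟩
  have had : a ≤ d := by omega
  have ha0 : (0 : ℝ) < a := by exact_mod_cast ha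
  have hd : (a : ℝ) ≤ d := by exact_mod_cast had
  have hd0 : (0 : ℝ) < d := by linarith
  have h := one_add_mul_self_le_rpow_one_add (s := 1 / (d : ℝ)) (by linarith [one_div_pos.2 hd0])
    (p := (d : ℝ) / a) (by rw [le_div_iff₀ ha0]; linarith)
  have h1 : (1 + 1 / (a : ℝ)) ^ a ≤ (1 + 1 / (d : ℝ)) ^ d := by
    calc (1 + 1 / (a : ℝ)) ^ a = (1 + (d : ℝ) / a * (1 / d)) ^ a := by
          congr 2; field_simp
      _ ≤ ((1 + 1 / (d : ℝ)) ^ ((d : ℝ) / a)) ^ a := pow_le_pow_left₀ (by positivity) h a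
      _ = (1 + 1 / (d : ℝ)) ^ d := by
          rw [← Real.rpow_natCast, ← Real.rpow_mul (by positivity), div_mul_cancel₀ _ ha0.ne',
            Real.rpow_natCast]
  unfold bzW
  have h2 : (1 - 1 / ((d + 1 : ℕ) : ℝ)) = (1 + 1 / (d : ℝ))⁻¹ := by
    push_cast; field_simp; ring
  rw [h2, Nat.add_sub_cancel, inv_pow]
  exact mul_inv_le_one_of_le₀ h1 (by positivity)

lemma bz_w_eq_one (a : ℕ) (ha : 1 ≤ a) : bzW a (a + 1) 1 = 1 := by
  have ha0 : (0 : ℝ) < a := by exact_mod_cast ha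
  unfold bzW
  rw [Nat.add_sub_cancel, ← mul_pow]
  have : (1 + 1 / (a : ℝ)) * (1 - 1 / ((a + 1 : ℕ) : ℝ)) = 1 := by
    push_cast; field_simp; ring
  rw [this, one_pow]

lemma bz_cdf_deriv (n b : ℕ) (hb : b < n) (t : ℝ) :
    HasDerivAt (fun t : ℝ => ∑ i ∈ Finset.range (b + 1), (n.choose i : ℝ) * t ^ i * (1 - t) ^ (n - i))
      (-((n.choose b : ℝ) * (n - b) * t ^ b * (1 - t) ^ (n - b - 1))) t := by
  have hone : HasDerivAt (fun t : ℝ => 1 - t) (-1) t := by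
    simpa using (hasDerivAt_id t).const_sub 1
  induction b with
  | zero =>
    have := hone.pow n
    simp only [zero_add, Finset.sum_range_one]
    have e : (fun t : ℝ => (n.choose 0 : ℝ) * t ^ 0 * (1 - t) ^ (n - 0)) =
        (fun t : ℝ => 1 - t) ^ n := by
      funext u; simp
    rw [e]
    refine this.congr_deriv ?_
    simp
  | succ k ih =>
    have ih := ih (by omega)
    simp only [Finset.sum_range_succ _ (k + 1)]
    have h2 : HasDerivAt (fun t : ℝ => (n.choose (k + 1) : ℝ) * t ^ (k + 1) * (1 - t) ^ (n - (k + 1)))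
        _ t := (((hasDerivAt_id t).pow (k + 1)).const_mul (n.choose (k + 1) : ℝ)).mul
          (hone.pow (n - (k + 1)))
    refine (ih.add h2).congr_deriv ?_
    have hc : (n.choose (k + 1) : ℝ) * (k + 1) = n.choose k * (n - k) := by
      have := Nat.choose_succ_right_eq n k
      have h3 : ((n.choose (k + 1) * (k + 1) : ℕ) : ℝ) = ((n.choose k * (n - k) : ℕ) : ℝ) := by
        rw [this]
      rw [Nat.cast_mul, Nat.cast_mul, Nat.cast_sub (by omega)] at h3
      push_cast at h3
      exact h3
    have e1 : n - k - 1 = n - (k + 1) := by omega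
    simp only [e1, id]
    rw [Nat.cast_sub (by omega : k + 1 ≤ n)]
    simp only [Nat.add_sub_cancel, Pi.pow_apply, id]
    push_cast
    linear_combination (t ^ k * (1 - t) ^ (n - (k + 1))) * hc

lemma bz_step (a c n : ℕ) (hn : n = a + c) (ha : 10 ≤ a) (hac : a + 1 ≤ c) (x y : ℝ)
    (hx : x = 1 / a) (hy : y = 1 / c) :
    ∃ J : ℝ, binZ a n = 1 + binZ (a + 1) n * bzW a c 1 - J ∧
      |J - (1 + y / 2 - (x + y) / 6 + y ^ 2 / 3 + (x ^ 2 - y ^ 2) / 12 - y * (x + y) / 8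
        + (x + y) ^ 2 / 40)| ≤ 10 * x ^ 3 := by
  have ha' : (10 : ℝ) ≤ a := by exact_mod_cast ha
  have hc' : (a : ℝ) + 1 ≤ c := by exact_mod_cast hac
  have ha0 : (0 : ℝ) < a := by linarith
  have hc0 : (0 : ℝ) < c := by linarith
  have hnr : (n : ℝ) = a + c := by rw [hn]; push_cast; ring
  have hn0 : (0 : ℝ) < n := by rw [hnr]; linarith
  have hCpos : (0 : ℝ) < n.choose a := by exact_mod_cast Nat.choose_pos (by omega)
  set F : ℝ → ℝ := fun t : ℝ =>
    ∑ i ∈ Finset.range (a + 1), (n.choose i : ℝ) * t ^ i * (1 - t) ^ (n - i) with hF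
  set P : ℝ := (n.choose a : ℝ) * ((a : ℝ) / n) ^ a * (1 - (a : ℝ) / n) ^ (n - a) with hP
  have hq : 1 - (a : ℝ) / n = c / n := by rw [hnr]; field_simp; ring
  have hna : n - a = c := by omega
  have hP' : P = (n.choose a : ℝ) * ((a : ℝ) / n) ^ a * ((c : ℝ) / n) ^ c := by
    rw [hP, hq, hna]
  have hPpos : 0 < P := by rw [hP']; positivity
  set K : ℝ → ℝ := fun s => - F ((a + s) / n) / P with hK
  have hKd : ∀ s, HasDerivAt K (bzW a c s) s := by
    intro s
    have h1 := bz_cdf_deriv n a (by omega) ((a + s) / n)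
    have h2 : HasDerivAt (fun s : ℝ => ((a : ℝ) + s) / n) (1 / n) s := by
      simpa using ((hasDerivAt_id s).const_add (a : ℝ)).div_const (n : ℝ)
    have h3 := ((h1.comp s h2).neg).div_const P
    refine h3.congr_deriv ?_
    have e1 : ((a : ℝ) + s) / n = a / n * (1 + s / a) := by field_simp
    have e2 : 1 - ((a : ℝ) + s) / n = c / n * (1 - s / c) := by
      rw [hnr]; field_simp; ring
    have e3 : (n : ℝ) - a = c := by rw [hnr]; ring
    rw [e2, e1, e3, hna, mul_pow, mul_pow]
    rw [div_eq_iff hPpos.ne', hP']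
    unfold bzW
    obtain ⟨d, rfl⟩ : ∃ d, c = d + 1 := ⟨c - 1, by omega⟩
    rw [Nat.add_sub_cancel, pow_succ (((d + 1 : ℕ) : ℝ) / n) d]
    ring
  refine ⟨K 1 - K 0, ?_, ?_⟩
  · have hK0 : K 0 = -(binP a n + P) / P := by
      simp only [hK, hF, add_zero, Finset.sum_range_succ _ a]
      rfl
    have hK1 : K 1 = -(binP (a + 1) n) / P := by
      simp only [hK, hF, binP]
      push_cast
      rfl
    have hP1 : (n.choose (a + 1) : ℝ) * (((a + 1 : ℕ) : ℝ) / n) ^ (a + 1) *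
        (1 - ((a + 1 : ℕ) : ℝ) / n) ^ (n - (a + 1)) = P * bzW a c 1 := by
      have hc1 : (n.choose (a + 1) : ℝ) * (a + 1) = n.choose a * c := by
        have := Nat.choose_succ_right_eq n a
        rw [hna] at this
        exact_mod_cast this
      have e1 : (((a + 1 : ℕ) : ℝ)) / n = a / n * (1 + 1 / a) := by push_cast; field_simp
      have e2 : 1 - ((a + 1 : ℕ) : ℝ) / n = c / n * (1 - 1 / c) := by
        rw [hnr]; push_cast; field_simp; ring
      have e5 : n - (a + 1) = c - 1 := by omega
      rw [e2, e5, pow_succ]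
      nth_rewrite 1 [e1]
      rw [hP']
      unfold bzW
      obtain ⟨d, rfl⟩ : ∃ d, c = d + 1 := ⟨c - 1, by omega⟩
      rw [Nat.add_sub_cancel, pow_succ (((d + 1 : ℕ) : ℝ) / n) d, mul_pow, mul_pow]
      push_cast at hc1 ⊢
      linear_combination (((a : ℝ) / n) ^ a * (1 + 1 / (a : ℝ)) ^ a / n *
        ((((d : ℝ) + 1) / n) ^ d * (1 - 1 / ((d : ℝ) + 1)) ^ d)) * hc1
    have hWpos : 0 < bzW a c 1 := by
      unfold bzW
      have : (0 : ℝ) < 1 - 1 / c := by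
        rw [sub_pos, div_lt_one hc0]; linarith
      positivity
    have z1 : binZ (a + 1) n = (1 / 2 - binP (a + 1) n) / (P * bzW a c 1) := by
      unfold binZ; rw [hP1]
    have z0 : binZ a n = (1 / 2 - binP a n) / P := rfl
    rw [z0, z1, hK0, hK1]
    field_simp
    ring
  · set Q : ℝ → ℝ := fun s => s + (s ^ 2 * y / 2 - s ^ 3 * (x + y) / 6) + (s ^ 3 * y ^ 2 / 3 +
      s ^ 4 * ((x ^ 2 - y ^ 2) / 12 - y * (x + y) / 8) + s ^ 5 * (x + y) ^ 2 / 40) with hQ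
    have hQd : ∀ s, HasDerivAt Q (1 + (s * y - s ^ 2 * (x + y) / 2)
      + (s ^ 3 * (x ^ 2 - y ^ 2) / 3 + s ^ 2 * y ^ 2 / 2)
      + (s * y - s ^ 2 * (x + y) / 2) ^ 2 / 2) s := by
      intro s
      have p1 := hasDerivAt_id s
      have p2 := ((hasDerivAt_pow 2 s).mul_const y).div_const 2
      have p3 := ((hasDerivAt_pow 3 s).mul_const (x + y)).div_const 6
      have p4 := ((hasDerivAt_pow 3 s).mul_const (y ^ 2)).div_const 3
      have p5 := (hasDerivAt_pow 4 s).mul_const ((x ^ 2 - y ^ 2) / 12 - y * (x + y) / 8)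
      have p6 := ((hasDerivAt_pow 5 s).mul_const ((x + y) ^ 2)).div_const 40
      refine ((p1.add (p2.sub p3)).add ((p4.add p5).add p6)).congr_deriv ?_
      norm_num
      ring
    have := norm_image_sub_le_of_norm_deriv_le_segment_01' (f := fun s => K s - Q s)
      (C := 10 * x ^ 3) (fun s _ => ((hKd s).sub (hQd s)).hasDerivWithinAt)
      (fun s hs => by
        rw [Real.norm_eq_abs]
        exact bz_w_bound a c x y s hx hy ha (by omega) hs.1 hs.2.le)
    rw [Real.norm_eq_abs] at this
    refine le_trans (le_of_eq ?_) this
    congr 1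
    simp only [hQ]
    ring

lemma bz_symm (a c n : ℕ) (hn : n = a + c) (ha : 0 < a) (hc : 0 < c) :
    binZ a n = 1 - binZ c n := by
  have ha0 : (0 : ℝ) < a := by exact_mod_cast ha
  have hc0 : (0 : ℝ) < c := by exact_mod_cast hc
  have hnr : (n : ℝ) = a + c := by rw [hn]; push_cast; ring
  have hn0 : (0 : ℝ) < n := by rw [hnr]; linarith
  have hq : 1 - (a : ℝ) / n = c / n := by rw [hnr]; field_simp; ring
  have hq' : 1 - (c : ℝ) / n = a / n := by rw [hnr]; field_simp; ring
  have hCpos : (0 : ℝ) < n.choose a := by exact_mod_cast Nat.choose_pos (by omega)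
  have hch : n.choose c = n.choose a := by
    rw [hn]; exact (Nat.choose_symm_add).symm
  have hna : n - a = c := by omega
  have hnc : n - c = a := by omega
  set P : ℝ := (n.choose a : ℝ) * ((a : ℝ) / n) ^ a * ((c : ℝ) / n) ^ c with hP
  have hPpos : 0 < P := by rw [hP]; positivity
  set g : ℕ → ℝ := fun i => (n.choose i : ℝ) * ((a : ℝ) / n) ^ i * ((c : ℝ) / n) ^ (n - i) with hg
  have htot : ∑ i ∈ Finset.range (n + 1), g i = 1 := by
    have h := add_pow ((a : ℝ) / n) ((c : ℝ) / n) n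
    have h1 : (a : ℝ) / n + c / n = 1 := by rw [← hq]; ring
    rw [h1, one_pow] at h
    rw [h]
    exact Finset.sum_congr rfl (fun i _ => by simp only [hg]; ring)
  have hA : binP a n = ∑ i ∈ Finset.range a, g i := by
    unfold binP; rw [hq]
  have hC : binP c n = ∑ i ∈ Finset.range c, g (a + 1 + i) := by
    rw [← Finset.sum_range_reflect]
    unfold binP
    rw [hq']
    refine Finset.sum_congr rfl (fun i hi => ?_)
    have hi := Finset.mem_range.1 hi
    have e : a + 1 + (c - 1 - i) = n - i := by omega
    simp only [hg]
    rw [e, Nat.choose_symm (by omega), show n - (n - i) = i by omega]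
    ring
  have hsum : binP a n + P + binP c n = 1 := by
    rw [← htot, hn, show a + c + 1 = (a + 1) + c by ring, Finset.sum_range_add,
      Finset.sum_range_succ, ← hn, hA, hC]
    simp only [hg, hP, hna]
  have z0 : binZ a n = (1 / 2 - binP a n) / P := by
    unfold binZ; rw [hq, hna]
  have z1 : binZ c n = (1 / 2 - binP c n) / P := by
    unfold binZ; rw [hq', hnc, hch, hP]; congr 1; ring
  rw [z0, z1]
  field_simp
  linarith

set_option maxHeartbeats 1000000 in
/-- main local estimate -/
lemma bz_local (a c n : ℕ) (hn : n = a + c) (ha : 10 ≤ a) (hac : a + 1 ≤ c) (x : ℝ)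
    (hx : x = 1 / a) :
    ∃ J : ℝ, binZ a n = 1 + binZ (a + 1) n * bzW a c 1 - J ∧
      J - (1 - (1 + (a : ℝ) / n) / 3) - (1 + ((a : ℝ) + 1) / n) / 3 * bzW a c 1
        ≤ - x ^ 2 / 24 + 21 * x ^ 3 ∧
      - x ^ 2 / 15 - 21 * x ^ 3 ≤
        J - (1 - (1 + (a : ℝ) / n) / 3) - (1 + ((a : ℝ) + 1) / n) / 3 * bzW a c 1 := by
  obtain ⟨y, hy⟩ : ∃ y : ℝ, y = 1 / c := ⟨_, rfl⟩
  obtain ⟨J, hJ, hJb⟩ := bz_step a c n hn ha hac x y hx hy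
  have hw := bz_w_bound a c x y 1 hx hy ha (by omega) zero_le_one le_rfl
  refine ⟨J, hJ, ?_⟩
  have ha' : (10 : ℝ) ≤ a := by exact_mod_cast ha
  have hc' : (a : ℝ) + 1 ≤ c := by exact_mod_cast hac
  have ha0 : (0 : ℝ) < a := by linarith
  have hc0 : (0 : ℝ) < c := by linarith
  have hnr : (n : ℝ) = a + c := by rw [hn]; push_cast; ring
  have hx0 : 0 < x := by rw [hx]; positivity
  have hy0 : 0 < y := by rw [hy]; positivity
  have hyx : y ≤ x := by rw [hx, hy]; exact one_div_le_one_div_of_le ha0 (by linarith)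
  generalize bzW a c 1 = W at hw ⊢
  obtain ⟨f, hf⟩ : ∃ f, f = (x + 2 * y) / (3 * (x + y)) := ⟨_, rfl⟩
  obtain ⟨h, hh⟩ : ∃ h, h = x * y / (3 * (x + y)) := ⟨_, rfl⟩
  have ef : (1 + (a : ℝ) / n) / 3 = f := by
    rw [hf, hx, hy, hnr]; field_simp; ring
  have eh : (1 + ((a : ℝ) + 1) / n) / 3 = f + h := by
    rw [hf, hh, hx, hy, hnr]; field_simp; ring
  rw [ef, eh]
  have hh0 : 0 ≤ h := by rw [hh]; positivity
  have hhx : h ≤ x / 3 := by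
    rw [hh, div_le_div_iff₀ (by positivity) (by norm_num)]; nlinarith
  have hfh0 : 0 ≤ f + h := by rw [hf, hh]; positivity
  have hfh1 : f + h ≤ 1 := by
    rw [← eh, hnr]
    have : ((a : ℝ) + 1) / (a + c) ≤ 1 := by rw [div_le_one (by linarith)]; linarith
    linarith
  obtain ⟨w2, hw2⟩ : ∃ w2, w2 = y ^ 2 + (x ^ 2 - y ^ 2) / 3 - y * (x + y) / 2 + (x + y) ^ 2 / 8 :=
    ⟨_, rfl⟩
  have key : (1 + y / 2 - (x + y) / 6 + y ^ 2 / 3 + (x ^ 2 - y ^ 2) / 12 - y * (x + y) / 8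
        + (x + y) ^ 2 / 40) - (1 - f) - (f + h) * (1 + (y - (x + y) / 2) + w2)
        = -(2 / 45) * (x ^ 2 - x * y / 2 + y ^ 2) - h * w2 := by
    rw [hw2, hf, hh]; field_simp; ring
  have hw' : |W - (1 + (y - (x + y) / 2) + w2)| ≤ 10 * x ^ 3 := by
    refine le_trans (le_of_eq ?_) hw
    congr 1
    rw [hw2]; ring
  have hw2b : |w2| ≤ 2 * x ^ 2 := by
    rw [hw2, abs_le]; constructor <;> nlinarith [mul_pos hx0 hy0]
  have hhw : |h * w2| ≤ x ^ 3 := by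
    rw [abs_mul, abs_of_nonneg hh0]
    have := mul_le_mul hhx hw2b (abs_nonneg _) (by positivity)
    nlinarith [pow_pos hx0 3]
  have hprod : |(f + h) * (W - (1 + (y - (x + y) / 2) + w2))| ≤ 10 * x ^ 3 := by
    rw [abs_mul, abs_of_nonneg hfh0]
    exact (mul_le_of_le_one_left (abs_nonneg _) hfh1).trans hw'
  rw [abs_le] at hJb hprod hhw
  have q1 : 15 / 16 * x ^ 2 ≤ x ^ 2 - x * y / 2 + y ^ 2 := by linarith [sq_nonneg (y - x / 4), (by ring : (y - x / 4) ^ 2 = y ^ 2 - x * y / 2 + x ^ 2 / 16)]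
  have q2 : x ^ 2 - x * y / 2 + y ^ 2 ≤ 3 / 2 * x ^ 2 := by
    have u1 : y ^ 2 ≤ x * y := by rw [pow_two]; exact mul_le_mul_of_nonneg_right hyx hy0.le
    have u2 : x * y ≤ x ^ 2 := by rw [pow_two]; exact mul_le_mul_of_nonneg_left hyx hx0.le
    linarith
  have split : J - (1 - f) - (f + h) * W =
      (J - (1 + y / 2 - (x + y) / 6 + y ^ 2 / 3 + (x ^ 2 - y ^ 2) / 12 - y * (x + y) / 8
        + (x + y) ^ 2 / 40)) - (f + h) * (W - (1 + (y - (x + y) / 2) + w2))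
        + (-(2 / 45) * (x ^ 2 - x * y / 2 + y ^ 2) - h * w2) := by
    rw [← key]; ring
  rw [split]
  constructor <;> linarith

lemma bz_lower (n : ℕ) : ∀ d b : ℕ, 2 * b + d = n → 10000 ≤ b →
    (1 + (b : ℝ) / n) / 3 ≤ binZ b n := by
  intro d
  induction d using Nat.strong_induction_on with
  | _ d ih =>
    intro b hbd hb
    have hb' : (10000 : ℝ) ≤ b := by exact_mod_cast hb
    have hnr : (n : ℝ) = 2 * b + d := by rw [← hbd]; push_cast; ring
    have hn0 : (0 : ℝ) < n := by
      have : (0 : ℝ) ≤ d := Nat.cast_nonneg d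
      rw [hnr]; linarith
    rcases Nat.eq_zero_or_pos d with h0 | hpos
    · subst h0
      have := bz_symm b b n (by omega) (by omega) (by omega)
      have e : (b : ℝ) / n = 1 / 2 := by
        rw [div_eq_iff hn0.ne', hnr]; push_cast; ring
      rw [e]; linarith
    obtain ⟨J, h1, h2, -⟩ := bz_local b (n - b) n (by omega) (by omega) (by omega) (1 / b) rfl
    have hneg : -(1 / (b : ℝ)) ^ 2 / 24 + 21 * (1 / (b : ℝ)) ^ 3 ≤ 0 := by
      have hx1 : 1 / (b : ℝ) ≤ 1 / 10000 := one_div_le_one_div_of_le (by norm_num) hb'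
      have hx0 : 0 < 1 / (b : ℝ) := by positivity
      nlinarith [pow_pos hx0 2]
    by_cases hd1 : d = 1
    · subst hd1
      have e : n - b = b + 1 := by omega
      rw [e, bz_w_eq_one b (by omega)] at h1 h2
      have hs := bz_symm b (b + 1) n (by omega) (by omega) (by omega)
      have e3 : ((b : ℝ) + 1) / n = 1 - b / n := by
        rw [eq_sub_iff_add_eq, ← add_div, div_eq_one_iff_eq hn0.ne', hnr]; push_cast; ring
      rw [e3] at h2
      linarith
    · have hi := ih (d - 2) (by omega) (b + 1) (by omega) (by omega)
      push_cast at hi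
      have hW : 0 ≤ bzW b (n - b) 1 := by
        unfold bzW
        have : (1 : ℝ) ≤ ((n - b : ℕ) : ℝ) := by exact_mod_cast (by omega : 1 ≤ n - b)
        have : (0 : ℝ) ≤ 1 - 1 / ((n - b : ℕ) : ℝ) := by
          rw [sub_nonneg, div_le_one (by linarith)]; exact this
        positivity
      have := mul_le_mul_of_nonneg_right hi hW
      linarith

lemma bz_incr (n b : ℕ) (hbn : 2 * b + 1 ≤ n) (hb : 10000 ≤ b)
    (hbig : 77 * (n : ℝ) / 360 < ((b : ℝ) + 1) ^ 2) : binZ b n < binZ (b + 1) n := by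
  have hb' : (10000 : ℝ) ≤ b := by exact_mod_cast hb
  have hn0 : (0 : ℝ) < n := by
    have : (2 * b + 1 : ℝ) ≤ n := by exact_mod_cast hbn
    linarith
  obtain ⟨J, h1, -, h2⟩ := bz_local b (n - b) n (by omega) (by omega) (by omega) (1 / b) rfl
  have hb0 : (0 : ℝ) < b := by linarith
  have hx1 : 1 / (b : ℝ) ≤ 1 / 10000 := one_div_le_one_div_of_le (by norm_num) hb'
  have hx0 : 0 < 1 / (b : ℝ) := by positivity
  have hpos : (1 / (b : ℝ)) ^ 2 / 15 + 21 * (1 / (b : ℝ)) ^ 3 < 1 / (3 * n) := by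
    have s1 : (1 / (b : ℝ)) ^ 2 / 15 + 21 * (1 / (b : ℝ)) ^ 3 ≤ (1 / (b : ℝ)) ^ 2 * (69 / 1000) := by
      nlinarith [pow_pos hx0 2]
    refine lt_of_le_of_lt s1 ?_
    rw [div_pow, one_pow, div_mul_eq_mul_div, div_lt_div_iff₀ (by positivity) (by positivity)]
    nlinarith
  have hfd : (1 + ((b : ℝ) + 1) / n) / 3 = (1 + (b : ℝ) / n) / 3 + 1 / (3 * n) := by
    field_simp; ring
  have hmul : 0 ≤ (1 - bzW b (n - b) 1) * (binZ (b + 1) n - (1 + ((b : ℝ) + 1) / n) / 3) := by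
    by_cases hd1 : 2 * b + 1 = n
    · have e : n - b = b + 1 := by omega
      rw [e, bz_w_eq_one b (by omega)]; simp
    · have hi := bz_lower n (n - 2 * (b + 1)) (b + 1) (by omega) (by omega)
      push_cast at hi
      exact mul_nonneg (sub_nonneg.2 (bz_w_le_one b (n - b) (by omega) (by omega)))
        (sub_nonneg.2 hi)
  nlinarith

theorem z_increasing_in_b_middle_range (ε : ℝ) (hε : 0 < ε) :
    ∃ N : ℕ, ∀ n : ℕ, N ≤ n → ∀ b : ℕ, 0 < b →
      (1 + ε) * Real.sqrt (77 * (n : ℝ) / 360) < (b : ℝ) →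
      (b : ℝ) < (n : ℝ) - (1 + ε) * Real.sqrt (77 * (n : ℝ) / 360) →
      binZ b n < binZ (b + 1) n := by
  refine ⟨10 ^ 9, fun n hn b hb0 hb1 hb2 => ?_⟩
  have hn' : (10 ^ 9 : ℝ) ≤ n := by exact_mod_cast hn
  set r := Real.sqrt (77 * (n : ℝ) / 360) with hr
  have hr2 : r ^ 2 = 77 * (n : ℝ) / 360 := Real.sq_sqrt (by positivity)
  have hr0 : 0 ≤ r := Real.sqrt_nonneg _
  have hrbig : (10001 : ℝ) < r := by
    rw [hr]; apply Real.lt_sqrt_of_sq_lt; linarith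
  have hre : r ≤ (1 + ε) * r := by nlinarith
  by_cases hc : 2 * b + 1 ≤ n
  · apply bz_incr n b hc
    · have : (10000 : ℝ) ≤ b := by linarith
      exact_mod_cast this
    · rw [← hr2]
      have : r < (b : ℝ) + 1 := by linarith
      nlinarith
  · have hbn : b < n := by
      have : (b : ℝ) < n := by linarith
      exact_mod_cast this
    obtain ⟨d, hd⟩ : ∃ d, n = b + 1 + d := ⟨n - (b + 1), by omega⟩
    have hdr : (n : ℝ) = b + 1 + d := by rw [hd]; push_cast; ring
    have hd1 : r < (d : ℝ) + 1 := by linarith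
    have hdb : 10000 ≤ d := by
      have : (10000 : ℝ) ≤ d := by linarith
      exact_mod_cast this
    have := bz_incr n d (by omega) hdb (by rw [← hr2]; nlinarith)
    have s1 := bz_symm d (b + 1) n (by omega) (by omega) (by omega)
    have s2 := bz_symm (d + 1) b n (by omega) (by omega) (by omega)
    linarith
end

section
/- For all positive integers b and n with n ≥ 3b + 2, one has p_{b+1,n} > p_{b,n}. -/
open Finset

lemma aux_deriv (n b : ℕ) (hb : b < n) (t : ℝ) :
    HasDerivAt (fun t : ℝ => ∑ i ∈ Finset.range (b+1), (n.choose i : ℝ) * t ^ i * (1 - t) ^ (n - i))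
      (-(((n:ℝ) - b) * (n.choose b : ℝ) * t ^ b * (1 - t) ^ (n - (b+1)))) t := by
  have h1 : HasDerivAt (fun t : ℝ => 1 - t) (-1) t := by
    simpa using (hasDerivAt_id t).const_sub 1
  induction b with
  | zero =>
    have := h1.fun_pow n
    simp only [zero_add, Finset.sum_range_one, Nat.choose_zero_right, pow_zero, Nat.sub_zero]
    have hf : (fun t : ℝ => ((1:ℕ):ℝ) * 1 * (1 - t)^n) = fun t => (1-t)^n := by
      funext t; simp
    rw [hf]
    refine this.congr_deriv ?_
    push_cast; ring
  | succ b ih =>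
    have ih := ih (by omega)
    obtain ⟨k, rfl⟩ : ∃ k, n = b + 2 + k := ⟨n - (b+2), by omega⟩
    have e1 : b + 2 + k - (b + 1) = k + 1 := by omega
    have e2 : b + 2 + k - (b + 1 + 1) = k := by omega
    have hd := ((hasDerivAt_pow (b+1) t).const_mul ((b+2+k).choose (b+1) : ℝ)).mul (h1.fun_pow (k+1))
    have hs := ih.add hd
    have hc : ((b+2+k).choose (b+1) : ℝ) * (b+1) = ((b+2+k).choose b : ℝ) * (k+2) := by
      have := Nat.choose_succ_right_eq (b+2+k) b
      rw [show b + 2 + k - b = k + 2 by omega] at this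
      exact_mod_cast this
    rw [e1] at hs
    rw [e2]
    have hf : (fun t : ℝ => ∑ i ∈ Finset.range (b+1+1), ((b+2+k).choose i : ℝ) * t ^ i * (1 - t) ^ (b+2+k - i))
        = ((fun t => ∑ i ∈ range (b + 1), ((b + 2 + k).choose i : ℝ) * t ^ i * (1 - t) ^ (b + 2 + k - i)) +
      (fun y => ((b + 2 + k).choose (b + 1) : ℝ) * y ^ (b + 1)) * fun i => (1 - i) ^ (k + 1)) := by
      funext t
      rw [Finset.sum_range_succ _ (b+1), e1]
      rfl
    rw [hf]
    refine hs.congr_deriv ?_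
    · simp only [Nat.add_sub_cancel]
      push_cast
      linear_combination (t^b * (1-t)^(k+1)) * hc

lemma log_add_bound (u : ℝ) (h0 : 0 ≤ u) (h1 : u ≤ 1) :
    Real.log (1 + u) ≤ u - u^2/2 + u^3/3 - u^4/8 := by
  have hm : MonotoneOn (fun u : ℝ => u - u^2/2 + u^3/3 - u^4/8 - Real.log (1+u)) (Set.Icc 0 1) := by
    have hd : ∀ x : ℝ, 0 ≤ x → HasDerivAt (fun u : ℝ => u - u^2/2 + u^3/3 - u^4/8 - Real.log (1+u))
        (1 - x + x^2 - x^3/2 - 1/(1+x)) x := by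
      intro x hx
      have hl := ((hasDerivAt_id x).const_add 1).log (by simp; positivity)
      have := (((((hasDerivAt_id x).sub ((hasDerivAt_pow 2 x).div_const 2)).add
        ((hasDerivAt_pow 3 x).div_const 3)).sub ((hasDerivAt_pow 4 x).div_const 8)).sub hl)
      refine this.congr_deriv ?_
      norm_num
      ring
    refine monotoneOn_of_hasDerivWithinAt_nonneg (convex_Icc 0 1) 
      (fun x hx => (hd x hx.1).continuousAt.continuousWithinAt) 
      (fun x hx => (hd x (interior_subset hx).1).hasDerivWithinAt) ?_
    intro x hx
    have hx := interior_subset hx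
    have hx0 : 0 ≤ x := hx.1
    have hx1 : x ≤ 1 := hx.2
    have : 1 - x + x^2 - x^3/2 - 1/(1+x) = x^3 * (1-x) / 2 / (1+x) := by
      field_simp
      ring
    rw [this]
    have : 0 ≤ 1 - x := by linarith
    positivity
  have := hm (Set.left_mem_Icc.2 zero_le_one) ⟨h0, h1⟩ h0
  simp at this
  linarith

lemma log_sub_bound (u : ℝ) (h0 : 0 ≤ u) (h1 : u < 1) :
    Real.log (1 - u) ≤ - u - u^2/2 - u^3/3 := by
  have hs := Real.hasSum_pow_div_log_of_abs_lt_one (x := u) (by rw [abs_of_nonneg h0]; exact h1)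
  have := hs.summable.sum_le_tsum (Finset.range 3) (fun i _ => by positivity)
  rw [hs.tsum_eq] at this
  norm_num [Finset.sum_range_succ] at this
  linarith

set_option maxHeartbeats 1000000 in
lemma g_bound (b m : ℕ) (hb : 0 < b) (hm : 2 * b + 2 ≤ m) (s e w a : ℝ) (hs0 : 0 ≤ s) (hs1 : s ≤ 1)
    (he : e = 1 / b) (hw : w = 1 / (2 * b + 2))
    (ha : a = w*s+(-e/2-w/2+w^2/2)*s^2+(e^2/3-w^2/3+w^3/3)*s^3-e^3/8*s^4) :
    (1 + s / b)^b * (1 - s / m)^(m-1) ≤ 1 + a + a^2 := by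
  have hbR : (1:ℝ) ≤ b := by exact_mod_cast hb
  have hmR : 2 * (b:ℝ) + 2 ≤ m := by exact_mod_cast hm
  have he0 : 0 < e := by rw [he]; positivity
  have he1 : e ≤ 1 := by rw [he, div_le_one (by positivity)]; exact hbR
  have hw0 : 0 < w := by rw [hw]; positivity
  have hw1 : w ≤ 1/4 := by
    rw [hw]; apply one_div_le_one_div_of_le <;> linarith
  obtain ⟨v, hv⟩ : ∃ v : ℝ, v = 1 / m := ⟨_, rfl⟩
  have hv0 : 0 < v := by rw [hv]; apply one_div_pos.2; linarith
  have hvw : v ≤ w := by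
    rw [hv, hw]; apply one_div_le_one_div_of_le <;> linarith
  have hbe : b * e = 1 := by rw [he]; field_simp
  have hmv : m * v = 1 := by rw [hv]; exact mul_one_div_cancel (by linarith)
  have hsb : s / b = s * e := by rw [he]; ring
  have hsm : s / m = s * v := by rw [hv]; ring
  have hse0 : 0 ≤ s * e := by positivity
  have hse1 : s * e ≤ 1 := by nlinarith
  have hsv0 : 0 ≤ s * v := by positivity
  have hsv1 : s * v < 1 := by nlinarith
  have l1 := log_add_bound (s*e) hse0 hse1
  have l2 := log_sub_bound (s*v) hsv0 hsv1
  have hm1 : ((m - 1 : ℕ) : ℝ) = m - 1 := by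
    rw [Nat.cast_sub (by omega)]; simp
  have hpos : 0 < (1 + s * e)^b * (1 - s * v)^(m-1) := by
    apply mul_pos <;> apply pow_pos <;> linarith
  have hlog : Real.log ((1 + s * e)^b * (1 - s * v)^(m-1)) ≤ a := by
    rw [Real.log_mul (by apply pow_ne_zero; linarith) (by apply pow_ne_zero; linarith),
      Real.log_pow, Real.log_pow, hm1]
    have k1 := mul_le_mul_of_nonneg_left l1 (by positivity : (0:ℝ) ≤ b)
    have k2 := mul_le_mul_of_nonneg_left l2 (by linarith : (0:ℝ) ≤ (m:ℝ) - 1)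
    have k1' : (b:ℝ) * (s*e - (s*e)^2/2 + (s*e)^3/3 - (s*e)^4/8)
        = s - e*s^2/2 + e^2*s^3/3 - e^3*s^4/8 := by
      linear_combination (s - e*s^2/2 + e^2*s^3/3 - e^3*s^4/8) * hbe
    have k2' : ((m:ℝ)-1) * (- (s*v) - (s*v)^2/2 - (s*v)^3/3)
        = (1 - v) * (- s - s^2*v/2 - s^3*v^2/3) := by
      linear_combination (- s - s^2*v/2 - s^3*v^2/3) * hmv
    rw [k1'] at k1
    rw [k2'] at k2
    have k3 : (1 - v) * (- s - s^2*v/2 - s^3*v^2/3) ≤ (1 - w) * (- s - s^2*w/2 - s^3*w^2/3) := by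
      have : (1 - w) * (- s - s^2*w/2 - s^3*w^2/3) - (1 - v) * (- s - s^2*v/2 - s^3*v^2/3)
        = (w - v) * s * ((1 - s/2) + s * (w+v)/2 * (1 - 2*s/3) + s^2*(w^2+w*v+v^2)/3) := by ring
      have h1 : 0 ≤ w - v := by linarith
      have h2 : 0 ≤ 1 - s/2 := by linarith
      have h3 : 0 ≤ 1 - 2*s/3 := by linarith
      have : 0 ≤ (w - v) * s * ((1 - s/2) + s * (w+v)/2 * (1 - 2*s/3) + s^2*(w^2+w*v+v^2)/3) := by
        positivity
      linarith
    rw [ha]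
    linarith
  have habs : |a| ≤ 1 := by
    have p1 : s^2 ≤ 1 := pow_le_one₀ hs0 hs1
    have p2 : s^3 ≤ 1 := pow_le_one₀ hs0 hs1
    have p3 : s^4 ≤ 1 := pow_le_one₀ hs0 hs1
    have q2 : e^2 ≤ 1 := pow_le_one₀ he0.le he1
    have q3 : e^3 ≤ 1 := pow_le_one₀ he0.le he1
    have r2 : w^2 ≤ 1/16 := by nlinarith
    have r3 : w^3 ≤ w^2 := by nlinarith [sq_nonneg w]
    have r30 : 0 < w^3 := by positivity
    have t1 : w * s ≤ 1/4 := by nlinarith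
    have t1' : 0 ≤ w * s := by positivity
    have t2 : (e/2+w/2-w^2/2)*s^2 ≤ 5/8 := by
      calc _ ≤ (5/8:ℝ) * 1 := by
            apply mul_le_mul _ p1 (by positivity) (by norm_num)
            nlinarith
        _ = _ := by norm_num
    have t2' : 0 ≤ (e/2+w/2-w^2/2)*s^2 := by
      apply mul_nonneg _ (by positivity)
      nlinarith
    have t3 : (e^2/3-w^2/3+w^3/3)*s^3 ≤ 1/3 := by
      calc _ ≤ (1/3:ℝ) * 1 := by
            apply mul_le_mul _ p2 (by positivity) (by norm_num)
            linarith
        _ = _ := by norm_num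
    have t3' : -(1/48) ≤ (e^2/3-w^2/3+w^3/3)*s^3 := by
      have : 0 ≤ (e^2/3-w^2/3+w^3/3 + 1/48)*s^3 := by
        apply mul_nonneg _ (by positivity)
        linarith [sq_nonneg e]
      linarith
    have t4 : e^3*s^4 ≤ 1 := mul_le_one₀ q3 (by positivity) p3
    have t4' : 0 ≤ e^3*s^4 := by positivity
    rw [abs_le, ha]
    constructor <;> linarith
  have hexp := (abs_le.1 (Real.abs_exp_sub_one_sub_id_le habs)).2
  rw [hsb, hsm]
  have := (Real.log_le_iff_le_exp hpos).1 hlog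
  linarith

lemma Q_bound (c e w : ℝ) (hc : 0 ≤ c) (he : e = 1 / (c+1)) (hw : w = 1 / (2 * (c+1) + 2))
    (a1 a2 a3 a4 : ℝ) (h1 : a1 = w) (h2 : a2 = -e/2-w/2+w^2/2) (h3 : a3 = e^2/3-w^2/3+w^3/3)
    (h4 : a4 = -e^3/8) :
    a1/2 + a2/3 + a3/4 + a4/5 + (a1^2/3 + 2*a1*a2/4 + (a2^2+2*a1*a3)/5 + (2*a1*a4+2*a2*a3)/6
      + (a3^2+2*a2*a4)/7 + 2*a3*a4/8 + a4^2/9) < 0 := by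
  have hw' : w = 1 / (2 * (c + 2)) := by rw [hw]; congr 1; ring
  subst h1 h2 h3 h4 he
  rw [hw']
  rw [← sub_pos]
  field_simp
  ring_nf
  positivity

theorem p_increasing_in_b (b n : ℕ) (hb : 0 < b) (hn : 3 * b + 2 ≤ n) :
    binP b n < binP (b + 1) n := by
  obtain ⟨m, rfl⟩ : ∃ m, n = b + m := ⟨n - b, by omega⟩
  have hm : 2 * b + 2 ≤ m := by omega
  have hbR : (1:ℝ) ≤ b := by exact_mod_cast hb
  have hmR : 2 * (b:ℝ) + 2 ≤ m := by exact_mod_cast hm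
  have hm0 : (0:ℝ) < m := by linarith
  obtain ⟨e, he⟩ : ∃ e : ℝ, e = 1 / b := ⟨_, rfl⟩
  obtain ⟨w, hw⟩ : ∃ w : ℝ, w = 1 / (2 * b + 2) := ⟨_, rfl⟩
  obtain ⟨a1, h1⟩ : ∃ a : ℝ, a = w := ⟨_, rfl⟩
  obtain ⟨a2, h2⟩ : ∃ a : ℝ, a = -e/2-w/2+w^2/2 := ⟨_, rfl⟩
  obtain ⟨a3, h3⟩ : ∃ a : ℝ, a = e^2/3-w^2/3+w^3/3 := ⟨_, rfl⟩
  obtain ⟨a4, h4⟩ : ∃ a : ℝ, a = -e^3/8 := ⟨_, rfl⟩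
  have hQ := Q_bound (b - 1) e w (by linarith) (by rw [he]; ring) (by rw [hw]; ring)
    a1 a2 a3 a4 h1 h2 h3 h4
  set N : ℝ := ((b + m : ℕ) : ℝ) with hN
  have hN' : N = b + m := by rw [hN]; push_cast; ring
  have hN0 : 0 < N := by rw [hN']; linarith
  set F : ℝ → ℝ := fun t : ℝ => ∑ i ∈ Finset.range (b+1),
    ((b+m).choose i : ℝ) * t ^ i * (1 - t) ^ (b + m - i) with hF
  set K : ℝ := ((b+m).choose b : ℝ) * ((b:ℝ)/N)^b * (1 - (b:ℝ)/N)^m with hK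
  have hx1 : 1 - (b:ℝ)/N = m / N := by rw [hN']; field_simp; ring
  have hK0 : 0 < K := by
    rw [hK, hx1]
    have : 0 < (b+m).choose b := Nat.choose_pos (by omega)
    positivity
  set Q : ℝ → ℝ := fun s => s + a1/2*s^2 + a2/3*s^3 + a3/4*s^4 + a4/5*s^5
    + (a1^2/3*s^3 + 2*a1*a2/4*s^4 + (a2^2+2*a1*a3)/5*s^5 + (2*a1*a4+2*a2*a3)/6*s^6
      + (a3^2+2*a2*a4)/7*s^7 + 2*a3*a4/8*s^8 + a4^2/9*s^9) with hQdef
  have hQd : ∀ s, HasDerivAt Q (1 + (a1*s+a2*s^2+a3*s^3+a4*s^4) + (a1*s+a2*s^2+a3*s^3+a4*s^4)^2) s := by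
    intro s
    have P := fun (k : ℕ) (c : ℝ) => (hasDerivAt_pow k s).const_mul c
    have := (((((hasDerivAt_id s).add (P 2 (a1/2))).add (P 3 (a2/3))).add (P 4 (a3/4))).add
      (P 5 (a4/5))).add (((((((P 3 (a1^2/3)).add (P 4 (2*a1*a2/4))).add (P 5 ((a2^2+2*a1*a3)/5))).add
      (P 6 ((2*a1*a4+2*a2*a3)/6))).add (P 7 ((a3^2+2*a2*a4)/7))).add (P 8 (2*a3*a4/8))).add
      (P 9 (a4^2/9)))
    refine this.congr_deriv ?_
    push_cast
    ring
  have hFd : ∀ s : ℝ, HasDerivAt (fun s : ℝ => F ((b + s)/N))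
      (-(K * ((1 + s / b)^b * (1 - s / m)^(m-1)))) s := by
    intro s
    have hi : HasDerivAt (fun s : ℝ => ((b:ℝ) + s)/N) (1/N) s := by
      simpa using ((hasDerivAt_id s).const_add (b:ℝ)).div_const N
    have := (aux_deriv (b+m) b (by omega) ((b+s)/N)).comp s hi
    refine this.congr_deriv ?_
    have e1 : ((b:ℝ) + s)/N = (b/N) * (1 + s/b) := by field_simp
    have e2 : 1 - ((b:ℝ) + s)/N = (m/N) * (1 - s/m) := by rw [hN']; field_simp; ring
    rw [e2, e1, hK, hx1, ← hN, mul_pow, mul_pow]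
    obtain ⟨k, rfl⟩ : ∃ k, m = k + 1 := ⟨m - 1, by omega⟩
    rw [show b + (k+1) - (b+1) = k by omega, Nat.add_sub_cancel, hN']
    rw [pow_succ]
    ring
  have hmono : MonotoneOn (fun s => F ((b+s)/N) + K * Q s) (Set.Icc 0 1) := by
    have hd := fun s => (hFd s).add ((hQd s).const_mul K)
    refine monotoneOn_of_hasDerivWithinAt_nonneg (convex_Icc 0 1)
      (fun x hx => (hd x).continuousAt.continuousWithinAt)
      (fun x hx => (hd x).hasDerivWithinAt) ?_
    intro s hs
    have hs := interior_subset hs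
    have := g_bound b m hb hm s e w (a1*s+a2*s^2+a3*s^3+a4*s^4) hs.1 hs.2 he hw
      (by rw [h1, h2, h3, h4]; ring)
    have := mul_le_mul_of_nonneg_left this hK0.le
    linarith
  have hfin := hmono (Set.left_mem_Icc.2 zero_le_one) (Set.right_mem_Icc.2 zero_le_one) zero_le_one
  have hQ0 : Q 0 = 0 := by simp [hQdef]
  have hQ1 : Q 1 < 1 := by simp only [hQdef]; linarith
  have hF1 : binP (b+1) (b+m) = F ((b+1)/N) := by
    simp only [binP, hF, hN]; push_cast; rfl
  have hF0 : binP b (b+m) + K = F ((b+0)/N) := by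
    simp only [binP, hF, add_zero]
    rw [Finset.sum_range_succ, Nat.add_sub_cancel_left]
  simp only [hQ0] at hfin
  rw [← hF0, ← hF1] at hfin
  nlinarith
end

section
/- For every C > 0 there exists a constant K > 0 such that for all positive integers b and n with n > C·b², one has |z_{b,n} − (1/3 + 4/(135b) + b/(3n))| ≤ K / (b·√b). -/
open Finset

lemma bz_deriv (n k : ℕ) (hk : k < n) (t : ℝ) :
    HasDerivAt (fun t : ℝ => ∑ i ∈ Finset.range (k+1), (n.choose i : ℝ) * t ^ i * (1 - t) ^ (n - i))
      (-((n - k : ℝ) * (n.choose k : ℝ) * t ^ k * (1 - t) ^ (n - k - 1))) t := by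
  induction k with
  | zero =>
    have h : HasDerivAt (fun t : ℝ => (1 - t) ^ n) ((n : ℝ) * (1 - t) ^ (n - 1) * (-1)) t := by
      have h1 : HasDerivAt (fun t : ℝ => 1 - t) (-1) t := by
        simpa using (hasDerivAt_id t).const_sub 1
      exact h1.pow n
    simpa using h
  | succ k ih =>
    have ih := ih (by omega)
    have h1 : HasDerivAt (fun t : ℝ => 1 - t) (-1) t := by
      simpa using (hasDerivAt_id t).const_sub 1
    have h2 := h1.pow (n - (k+1))
    have h3 := ((hasDerivAt_pow (k+1) t).mul h2).const_mul (n.choose (k+1) : ℝ)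
    have h4 := ih.add h3
    have hc : (n.choose (k+1) : ℝ) * (k + 1) = n.choose k * (n - k) := by
      have := Nat.choose_succ_right_eq n k
      have h5 : ((n - k : ℕ) : ℝ) = n - k := by
        rw [Nat.cast_sub (by omega)]
      rw [← h5]; exact_mod_cast this
    refine (h4.congr_deriv ?_).congr_of_eventuallyEq ?_
    · have e1 : n - k - 1 = n - (k+1) := by omega
      rw [e1, Nat.cast_sub (by omega : k + 1 ≤ n)]
      simp only [Pi.pow_apply, Nat.add_sub_cancel]
      push_cast
      linear_combination (t ^ k * (1 - t) ^ (n - (k+1))) * hc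
    · refine Filter.Eventually.of_forall fun s => ?_
      simp only [Pi.add_apply, Pi.mul_apply, Pi.pow_apply]
      rw [Finset.sum_range_succ _ (k+1)]
      ring

noncomputable def bzPi (k m : ℕ) : ℝ :=
  ((k+m).choose k : ℝ) * ((k : ℝ) / (k + m)) ^ k * ((m : ℝ) / (k + m)) ^ m

lemma bzPi_pos (k m : ℕ) (hk : 0 < k) (hm : 0 < m) : 0 < bzPi k m := by
  unfold bzPi
  have : 0 < (k+m).choose k := Nat.choose_pos (by omega)
  positivity

lemma binZ_eq (k m : ℕ) (hk : 0 < k) :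
    binZ k (k+m) = (1/2 - binP k (k+m)) / bzPi k m := by
  unfold binZ bzPi
  have hk' : (0:ℝ) < k := by exact_mod_cast hk
  have : 1 - (k:ℝ) / ((k + m : ℕ) : ℝ) = m / (k + m) := by
    push_cast; field_simp; ring
  rw [this, Nat.add_sub_cancel_left]
  push_cast; rfl

lemma bz_symm_s16 (k m : ℕ) (hk : 0 < k) (hm : 0 < m) :
    binZ k (k+m) + binZ m (k+m) = 1 := by
  have hp := bzPi_pos k m hk hm
  have e : bzPi m k = bzPi k m := by
    unfold bzPi
    rw [Nat.add_comm m k, Nat.choose_symm_add, add_comm (m:ℝ) k]; ring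
  have hk' : (0:ℝ) < k := by exact_mod_cast hk
  have hm' : (0:ℝ) < m := by exact_mod_cast hm
  have h2 : binZ m (k+m) = (1/2 - binP m (k+m)) / bzPi k m := by
    have := binZ_eq m k hm
    rw [e, Nat.add_comm m k] at this; exact this
  rw [h2, binZ_eq k m hk, ← add_div, div_eq_one_iff_eq hp.ne']
  have e1 : 1 - (k:ℝ) / ((k + m : ℕ) : ℝ) = m / (k + m) := by
    push_cast; field_simp; ring
  have e2 : 1 - (m:ℝ) / ((k + m : ℕ) : ℝ) = k / (k + m) := by
    push_cast; field_simp; ring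
  have tot := add_pow ((k:ℝ)/(k+m)) ((m:ℝ)/(k+m)) (k+m)
  have e3 : (k:ℝ)/(k+m) + (m:ℝ)/(k+m) = 1 := by field_simp
  rw [e3, one_pow, Nat.add_assoc k m 1, Finset.sum_range_add, Finset.sum_range_succ'] at tot
  have hA : binP k (k+m) = ∑ x ∈ Finset.range k, ((k:ℝ) / (k + m)) ^ x * ((m:ℝ) / (k + m)) ^ (k + m - x) * ((k + m).choose x : ℝ) := by
    unfold binP
    rw [e1]
    refine Finset.sum_congr rfl fun i _ => ?_
    push_cast; ring
  have hB : binP m (k+m) = ∑ x ∈ Finset.range m, ((k:ℝ) / (k + m)) ^ (k + (x+1)) * ((m:ℝ) / (k + m)) ^ (k + m - (k + (x+1))) * ((k + m).choose (k + (x+1)) : ℝ) := by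
    unfold binP
    rw [e2, ← Finset.sum_range_reflect]
    refine Finset.sum_congr rfl fun i hi => ?_
    have hi := Finset.mem_range.1 hi
    have f1 : k + m - (m - 1 - i) = k + (i+1) := by omega
    have f2 : k + m - (k + (i+1)) = m - 1 - i := by omega
    rw [f1, f2, ← Nat.choose_symm (by omega : k + (i+1) ≤ k + m), f2]
    push_cast; ring
  rw [← hA, ← hB] at tot
  unfold bzPi
  simp only [Nat.add_zero, Nat.add_sub_cancel_left] at tot
  linarith

noncomputable def bzG (k m : ℕ) (s : ℝ) : ℝ := (1 + s / k) ^ k * (1 - s / m) ^ (m - 1)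

noncomputable def bzH (k m : ℕ) (s : ℝ) : ℝ :=
  (∑ i ∈ Finset.range (k+1), ((k+m).choose i : ℝ) * ((k+s)/(k+m)) ^ i * (1 - (k+s)/(k+m)) ^ (k+m - i)) / bzPi k m

lemma bzH_deriv (k m : ℕ) (hk : 0 < k) (hm : 0 < m) (s : ℝ) :
    HasDerivAt (bzH k m) (- bzG k m s) s := by
  have hp := bzPi_pos k m hk hm
  have hk' : (0:ℝ) < k := by exact_mod_cast hk
  have hm' : (0:ℝ) < m := by exact_mod_cast hm
  have h1 : HasDerivAt (fun s : ℝ => ((k:ℝ)+s)/(k+m)) (1/(k+m)) s :=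
    ((hasDerivAt_id s).const_add (k:ℝ)).div_const _
  have h2 := bz_deriv (k+m) k (by omega) (((k:ℝ)+s)/(k+m))
  have h3 := (HasDerivAt.comp s h2 h1).div_const (bzPi k m)
  refine h3.congr_deriv ?_
  have e1 : 1 - (k+s)/(k+m:ℝ) = m/(k+m) * (1 - s/m) := by field_simp; ring
  have e2 : (k+s)/(k+m:ℝ) = k/(k+m) * (1 + s/k) := by field_simp
  rw [e1, e2, Nat.add_sub_cancel_left, div_eq_iff hp.ne']
  unfold bzG bzPi
  obtain ⟨j, rfl⟩ : ∃ j, m = j + 1 := ⟨m - 1, by omega⟩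
  simp only [Nat.add_sub_cancel, mul_pow]
  push_cast
  rw [pow_succ ((j + 1 : ℝ)/(k+(j+1))) j]
  ring

lemma bz_ratio (k m : ℕ) (hk : 0 < k) (hm : 0 < m) :
    bzPi (k+1) m = bzPi k (m+1) * bzG k (m+1) 1 := by
  have hk' : (0:ℝ) < k := by exact_mod_cast hk
  have hm' : (0:ℝ) < m := by exact_mod_cast hm
  unfold bzPi bzG
  have hc : ((k+1+m).choose (k+1) : ℝ) * (k + 1) = (k+(m+1)).choose k * (m + 1) := by
    have := Nat.choose_succ_right_eq (k+(m+1)) k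
    rw [Nat.add_sub_cancel_left] at this
    rw [show k + 1 + m = k + (m+1) by ring]
    exact_mod_cast this
  have hc' : ((k+1+m).choose (k+1) : ℝ) = (k+(m+1)).choose k * (m + 1) / (k+1) := by
    field_simp; linarith
  rw [hc', Nat.add_sub_cancel]
  push_cast
  have e1 : (1:ℝ) + 1/k = (k+1)/k := by field_simp
  have e2 : (1:ℝ) - 1/(m+1) = m/(m+1) := by field_simp; ring
  have e3 : (k:ℝ) + 1 + m = k + (m+1) := by ring
  rw [e1, e2, e3]
  simp only [div_pow]
  have : (k:ℝ) + (m+1) ≠ 0 := by positivity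
  field_simp
  ring

lemma bz_step_s16 (k m : ℕ) (hk : 0 < k) (hm : 0 < m) :
    binZ k (k+(m+1)) - bzG k (m+1) 1 * binZ (k+1) (k+(m+1)) = 1 - (bzH k (m+1) 0 - bzH k (m+1) 1) := by
  have hp := bzPi_pos k (m+1) hk (by omega)
  have hp2 := bzPi_pos (k+1) m (by omega) hm
  have hr := bz_ratio k m hk hm
  have hG : bzG k (m+1) 1 ≠ 0 := by
    intro h; rw [h, mul_zero] at hr; linarith
  have h1 := binZ_eq k (m+1) hk
  have h2 := binZ_eq (k+1) m (by omega)
  rw [show k + 1 + m = k + (m+1) by ring] at h2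
  rw [h1, h2, hr]
  have hk' : (0:ℝ) < k := by exact_mod_cast hk
  have e1 : 1 - (k:ℝ) / (k + ((m+1 : ℕ) : ℝ)) = ((m+1 : ℕ) : ℝ) / (k + ((m+1 : ℕ) : ℝ)) := by
    push_cast; field_simp; ring
  have a1 : bzH k (m+1) 1 = binP (k+1) (k+(m+1)) / bzPi k (m+1) := by
    unfold bzH binP; push_cast; rfl
  have a2 : bzH k (m+1) 0 = (binP k (k+(m+1)) + bzPi k (m+1)) / bzPi k (m+1) := by
    unfold bzH binP
    rw [Finset.sum_range_succ]
    congr 1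
    congr 1
    · push_cast; simp only [add_zero]
    · simp only [add_zero]
      rw [e1, Nat.add_sub_cancel_left]; rfl
  rw [a1, a2]
  field_simp
  ring

lemma bz_log (y : ℝ) (hy : |y| ≤ 1/2) : |Real.log (1 - y) + (y + y^2/2 + y^3/3)| ≤ 2 * |y|^4 := by
  have h := Real.abs_log_sub_add_sum_range_le (x := y) (by linarith) 3
  simp only [Finset.sum_range_succ, Finset.sum_range_zero] at h
  norm_num at h
  have h2 : |y|^4 / (1 - |y|) ≤ 2 * |y|^4 := by
    rw [div_le_iff₀ (by linarith)]
    nlinarith [pow_nonneg (abs_nonneg y) 4]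
  refine le_trans (le_of_eq ?_) (h.trans h2)
  congr 1; ring

set_option maxHeartbeats 1000000 in
lemma bzG_est_main (k m : ℕ) (hk : 3 ≤ k) (hkm : k ≤ m) (s : ℝ) (hs0 : 0 ≤ s) (hs1 : s ≤ 1) (a c : ℝ)
    (ha : a = 1 / k) (hc : c = 1 / m) :
    |bzG k m s - (1 + (c*s - s^2*(a+c)/2) + (s^2*c^2/2 + s^3/3*(a^2-c^2) + (c*s - s^2*(a+c)/2)^2/2))| ≤ 64 * a^3 := by
  have hk' : (3:ℝ) ≤ k := by exact_mod_cast hk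
  have hm' : (k:ℝ) ≤ m := by exact_mod_cast hkm
  have ha0 : 0 < a := by rw [ha]; positivity
  have hc0 : 0 < c := by rw [hc]; apply one_div_pos.2; linarith
  have hca : c ≤ a := by rw [ha, hc]; exact one_div_le_one_div_of_le (by linarith) hm'
  have ha3 : a ≤ 1/3 := by rw [ha]; exact one_div_le_one_div_of_le (by norm_num) hk'
  have hka : (k:ℝ) * a = 1 := by rw [ha]; field_simp
  have hmc : (m:ℝ) * c = 1 := by rw [hc]; apply mul_one_div_cancel; linarith
  have hsa : s * a ≤ a := mul_le_of_le_one_left ha0.le hs1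
  have hsc : s * c ≤ c := mul_le_of_le_one_left hc0.le hs1
  have hsa0 : 0 ≤ s * a := by positivity
  have hsc0 : 0 ≤ s * c := by positivity
  have l1 := bz_log (-(s*a)) (by rw [abs_neg, abs_of_nonneg hsa0]; linarith)
  have l2 := bz_log (s*c) (by rw [abs_of_nonneg hsc0]; linarith)
  rw [abs_neg, abs_of_nonneg hsa0] at l1
  rw [abs_of_nonneg hsc0] at l2
  have b1 : (s*a)^4 ≤ a^4 := pow_le_pow_left₀ hsa0 hsa 4
  have b2 : (s*c)^4 ≤ c^4 := pow_le_pow_left₀ hsc0 hsc 4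
  set X := Real.log (1 - -(s*a)) with hX
  set Y := Real.log (1 - s*c) with hY
  set L := k * X + (m - 1) * Y with hL
  have hGL : bzG k m s = Real.exp L := by
    unfold bzG
    rw [hL, Real.exp_add]
    congr 1
    · rw [Real.exp_nat_mul, hX, Real.exp_log (by linarith), ha]; congr 1; ring
    · have : (m:ℝ) - 1 = ((m-1 : ℕ) : ℝ) := by rw [Nat.cast_sub (by omega)]; simp
      rw [this, Real.exp_nat_mul, hY, Real.exp_log (by linarith), hc]; congr 1; ring
  have c3 : c^3 ≤ a^3 := pow_le_pow_left₀ hc0.le hca 3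
  have c2 : c^2 ≤ a^2 := pow_le_pow_left₀ hc0.le hca 2
  have d1 : |k * X - (s - s^2*a/2 + s^3*a^2/3)| ≤ 2 * a^3 := by
    have : k * X - (s - s^2*a/2 + s^3*a^2/3) = k * (X + (-(s*a) + (-(s*a))^2/2 + (-(s*a))^3/3)) := by
      linear_combination (s - s^2*a/2 + s^3*a^2/3) * hka
    rw [this, abs_mul, abs_of_nonneg (by linarith : (0:ℝ) ≤ k)]
    calc (k:ℝ) * _ ≤ k * (2 * a^4) := by gcongr; linarith
      _ = 2 * a^3 := by linear_combination 2 * a^3 * hka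
  have d2 : |(m-1) * Y + (m-1)*(s*c + (s*c)^2/2 + (s*c)^3/3)| ≤ 2 * a^3 := by
    rw [← mul_add, abs_mul, abs_of_nonneg (by linarith : (0:ℝ) ≤ m - 1)]
    calc ((m:ℝ)-1) * _ ≤ m * (2 * c^4) := by
          apply mul_le_mul (by linarith) (by linarith) (abs_nonneg _) (by linarith)
      _ = 2 * c^3 := by linear_combination 2 * c^3 * hmc
      _ ≤ 2 * a^3 := by linarith
  have s2 : s^2 ≤ 1 := pow_le_one₀ hs0 hs1
  have s3 : s^3 ≤ 1 := pow_le_one₀ hs0 hs1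
  have s20 : 0 ≤ s^2 := by positivity
  have s30 : 0 ≤ s^3 := by positivity
  set P := c*s - s^2*(a+c)/2 with hP
  set Q := s^2*c^2/2 + s^3/3*(a^2-c^2) with hQ
  have hPb : |P| ≤ a := by
    have t1 : 0 ≤ c*s := by positivity
    have t2 : c*s ≤ c := by linarith [mul_comm c s]
    have t3 : 0 ≤ s^2*(a+c) := by positivity
    have t4 : s^2*(a+c) ≤ a+c := mul_le_of_le_one_left (by linarith) s2
    rw [abs_le]; constructor <;> linarith
  have hQb : |Q| ≤ a^2 := by
    have t1 : 0 ≤ s^2*c^2 := by positivity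
    have t2 : s^2*c^2 ≤ c^2 := mul_le_of_le_one_left (sq_nonneg c) s2
    have t5 := sq_nonneg c
    have t3 : 0 ≤ s^3*(a^2-c^2) := mul_nonneg s30 (by linarith)
    have t4 : s^3*(a^2-c^2) ≤ a^2-c^2 := mul_le_of_le_one_left (by linarith) s3
    rw [abs_le]; constructor <;> linarith
  have hLD : |L - (P + Q)| ≤ 5 * a^3 := by
    have e : L - (P+Q) = (k * X - (s - s^2*a/2 + s^3*a^2/3)) + ((m-1) * Y + (m-1)*(s*c + (s*c)^2/2 + (s*c)^3/3)) + s^3*c^3/3 := by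
      rw [hL, hP, hQ]
      linear_combination (-(s + s^2*c/2+s^3*c^2/3)) * hmc
    have t0 : 0 ≤ s^3*c^3 := by positivity
    have t1 : s^3*c^3 ≤ c^3 := mul_le_of_le_one_left (by positivity) s3
    have t2 := pow_pos ha0 3
    obtain ⟨d11, d12⟩ := abs_le.1 d1
    obtain ⟨d21, d22⟩ := abs_le.1 d2
    rw [e, abs_le]
    constructor <;> linarith
  have a2 : a^2 ≤ a/3 := by
    have := mul_le_mul_of_nonneg_left ha3 ha0.le
    calc a^2 = a*a := by ring
      _ ≤ _ := by linarith
  have a3 : a^3 ≤ a^2/3 := by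
    have := mul_le_mul_of_nonneg_left ha3 (sq_nonneg a)
    calc a^3 = a^2*a := by ring
      _ ≤ _ := by linarith
  have hLP : |L - P| ≤ 3 * a^2 := by
    rw [abs_le] at hLD hQb ⊢; constructor <;> linarith
  have hLb : |L| ≤ 2 * a := by
    rw [abs_le] at hLP hPb ⊢; constructor <;> linarith
  have hE := Real.exp_bound (x := L) (by linarith) (n := 3) (by norm_num)
  simp only [Finset.sum_range_succ, Finset.sum_range_zero] at hE
  norm_num [Nat.factorial] at hE
  have hL3 : |L|^3 ≤ 8 * a^3 := by
    calc |L|^3 ≤ (2*a)^3 := pow_le_pow_left₀ (abs_nonneg _) hLb 3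
      _ = _ := by ring
  have hsq : |L^2 - P^2| ≤ 9 * a^3 := by
    have : L^2 - P^2 = (L - P) * (L + P) := by ring
    rw [this, abs_mul]
    have : |L + P| ≤ 3 * a := (abs_add_le _ _).trans (by linarith)
    calc _ ≤ (3*a^2) * (3*a) := mul_le_mul hLP this (abs_nonneg _) (by positivity)
      _ = _ := by ring
  rw [hGL]
  have a30 := pow_pos ha0 3
  rw [abs_le] at hE hLD hsq ⊢
  constructor <;> linarith

lemma bzG_est (k m : ℕ) (hk : 1 ≤ k) (hkm : k ≤ m) (s : ℝ) (hs0 : 0 ≤ s) (hs1 : s ≤ 1) (a c : ℝ)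
    (ha : a = 1 / k) (hc : c = 1 / m) :
    |bzG k m s - (1 + (c*s - s^2*(a+c)/2) + (s^2*c^2/2 + s^3/3*(a^2-c^2) + (c*s - s^2*(a+c)/2)^2/2))| ≤ 64 * a^3 := by
  by_cases h3 : 3 ≤ k
  · exact bzG_est_main k m h3 hkm s hs0 hs1 a c ha hc
  have hk' : (1:ℝ) ≤ k := by exact_mod_cast hk
  have hk2 : (k:ℝ) ≤ 2 := by exact_mod_cast (by omega : k ≤ 2)
  have hm' : (k:ℝ) ≤ m := by exact_mod_cast hkm
  have ha0 : 0 < a := by rw [ha]; positivity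
  have hc0 : 0 < c := by rw [hc]; apply one_div_pos.2; linarith
  have hca : c ≤ a := by rw [ha, hc]; exact one_div_le_one_div_of_le (by linarith) hm'
  have ha1 : a ≤ 1 := by rw [ha, div_le_one (by linarith)]; exact hk'
  have ha2 : 1/2 ≤ a := by rw [ha]; exact one_div_le_one_div_of_le (by linarith) hk2
  have a3 : 1/8 ≤ a^3 := by
    calc (1/8:ℝ) = (1/2)^3 := by norm_num
      _ ≤ a^3 := pow_le_pow_left₀ (by norm_num) ha2 3
  have s2 : s^2 ≤ 1 := pow_le_one₀ hs0 hs1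
  have s3 : s^3 ≤ 1 := pow_le_one₀ hs0 hs1
  have hsc : s * c ≤ c := mul_le_of_le_one_left hc0.le hs1
  have s20 : 0 ≤ s^2 := by positivity
  have s30 : 0 ≤ s^3 := by positivity
  have c2 : c^2 ≤ a^2 := pow_le_pow_left₀ hc0.le hca 2
  have a21 : a^2 ≤ 1 := pow_le_one₀ ha0.le ha1
  set P := c*s - s^2*(a+c)/2 with hP
  set Q := s^2*c^2/2 + s^3/3*(a^2-c^2) with hQ
  have hPb : |P| ≤ a := by
    have t1 : 0 ≤ c*s := by positivity
    have t2 : c*s ≤ c := by linarith [mul_comm c s]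
    have t3 : 0 ≤ s^2*(a+c) := by positivity
    have t4 : s^2*(a+c) ≤ a+c := mul_le_of_le_one_left (by linarith) s2
    rw [abs_le]; constructor <;> linarith
  have hQb : |Q| ≤ a^2 := by
    have t1 : 0 ≤ s^2*c^2 := by positivity
    have t2 : s^2*c^2 ≤ c^2 := mul_le_of_le_one_left (sq_nonneg c) s2
    have t5 := sq_nonneg c
    have t3 : 0 ≤ s^3*(a^2-c^2) := mul_nonneg s30 (by linarith)
    have t4 : s^3*(a^2-c^2) ≤ a^2-c^2 := mul_le_of_le_one_left (by linarith) s3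
    rw [abs_le]; constructor <;> linarith
  have hP2 : P^2 ≤ 1 := by rw [sq_le_one_iff_abs_le_one]; linarith
  have hP20 := sq_nonneg P
  have hsm : s / m ≤ 1 := by rw [div_le_one (by linarith)]; linarith
  have hsm0 : 0 ≤ s / m := by positivity
  have hg0 : 0 ≤ bzG k m s := by
    unfold bzG
    have : 0 ≤ 1 - s/m := by linarith
    positivity
  have hg1 : bzG k m s ≤ 4 := by
    unfold bzG
    have t1 : (1 - s/m)^(m-1) ≤ 1 := pow_le_one₀ (by linarith) (by linarith)
    have t0 : 0 ≤ (1 - s/m)^(m-1) := pow_nonneg (by linarith) _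
    have t2 : (1 + s/k)^k ≤ 4 := by
      have h2 : s/k ≤ 1 := by rw [div_le_one (by linarith)]; linarith
      have h20 : 0 ≤ s/k := by positivity
      calc (1 + s/k)^k ≤ 2^k := pow_le_pow_left₀ (by linarith) (by linarith) k
        _ ≤ 2^2 := pow_le_pow_right₀ (by norm_num) (by omega)
        _ = 4 := by norm_num
    nlinarith
  rw [abs_le] at hPb hQb ⊢
  constructor <;> linarith

lemma bzI_est (k m : ℕ) (hk : 1 ≤ k) (hkm : k ≤ m) (a c : ℝ)
    (ha : a = 1 / k) (hc : c = 1 / m) :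
    |(bzH k m 0 - bzH k m 1) - (1 + (c/2 - (a+c)/6) + (c^2/6 + (a^2-c^2)/12 + (c^2/3 - c*(a+c)/4 + (a+c)^2/20)/2))| ≤ 64 * a^3 := by
  let F : ℝ → ℝ := fun s => -bzH k m s - (s + (c*s^2/2 - s^3*(a+c)/6) + (s^3*c^2/6 + s^4/12*(a^2-c^2) + (c^2*s^3/3 - c*(a+c)*s^4/4 + s^5*(a+c)^2/20)/2))
  have hF : ∀ s, HasDerivAt F (bzG k m s - (1 + (c*s - s^2*(a+c)/2) + (s^2*c^2/2 + s^3/3*(a^2-c^2) + (c*s - s^2*(a+c)/2)^2/2))) s := by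
    intro s
    have h1 := (bzH_deriv k m (by omega) (by omega) s).neg
    have h2 := hasDerivAt_id s
    have p2 := hasDerivAt_pow 2 s
    have p3 := hasDerivAt_pow 3 s
    have p4 := hasDerivAt_pow 4 s
    have p5 := hasDerivAt_pow 5 s
    have := h1.sub ((h2.add (((p2.const_mul c).div_const 2).sub ((p3.mul_const (a+c)).div_const 6))).add
      ((((p3.mul_const (c^2)).div_const 6).add ((p4.div_const 12).mul_const (a^2-c^2))).add
      ((((((p3.const_mul (c^2)).div_const 3).sub ((p4.const_mul (c*(a+c))).div_const 4)).add ((p5.mul_const ((a+c)^2)).div_const 20)).div_const 2))))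
    refine this.congr_deriv ?_
    norm_num
    ring
  have := Convex.norm_image_sub_le_of_norm_hasDerivWithin_le (f := F) (s := Set.Icc (0:ℝ) 1) (C := 64*a^3)
    (fun x _ => (hF x).hasDerivWithinAt) (fun x hx => by
      rw [Real.norm_eq_abs]; exact bzG_est k m hk hkm x hx.1 hx.2 a c ha hc) (convex_Icc 0 1)
    (Set.left_mem_Icc.2 zero_le_one) (Set.right_mem_Icc.2 zero_le_one)
  rw [Real.norm_eq_abs, Real.norm_eq_abs] at this
  norm_num at this
  refine le_trans (le_of_eq ?_) this
  congr 1
  simp only [F]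
  ring

lemma bzG_le_one (k m : ℕ) (hk : 1 ≤ k) (hkm : k ≤ m) : bzG k (m+1) 1 ≤ 1 := by
  have hk' : (1:ℝ) ≤ k := by exact_mod_cast hk
  have hm' : (k:ℝ) ≤ m := by exact_mod_cast hkm
  have hm0 : (0:ℝ) < m := by linarith
  unfold bzG
  have h := one_add_mul_self_le_rpow_one_add (s := 1/(m:ℝ)) (by
    have : (0:ℝ) ≤ 1/m := by positivity
    linarith) (p := (m:ℝ)/k) (by rw [le_div_iff₀ (by linarith)]; linarith)
  have e1 : (m:ℝ)/k * (1/m) = 1/k := by field_simp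
  rw [e1] at h
  have h2 := pow_le_pow_left₀ (by positivity) h k
  rw [← Real.rpow_natCast, ← Real.rpow_natCast, ← Real.rpow_mul (by positivity)] at h2
  have e2 : (m:ℝ)/k * k = (m:ℕ) := by field_simp
  rw [e2, Real.rpow_natCast, Real.rpow_natCast] at h2
  rw [Nat.add_sub_cancel]
  push_cast
  have e3 : (1:ℝ) - 1/((m:ℝ)+1) = (1 + 1/(m:ℝ))⁻¹ := by field_simp; ring
  rw [e3, inv_pow, ← div_eq_mul_inv, div_le_one (by positivity)]
  exact h2

noncomputable def bzZeta (k m : ℝ) : ℝ :=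
  (1 + k/(k+m))/3 + 4/135*(1/k - 1/m) + 2/135*((m-k)/(k+m)^2)

lemma bzZeta_symm (k m : ℝ) (hk : 0 < k) (hm : 0 < m) : bzZeta k m + bzZeta m k = 1 := by
  unfold bzZeta; field_simp; ring

set_option maxHeartbeats 1000000 in
lemma bzZeta_step (k m : ℝ) (hk : 1 ≤ k) (hm : k + 1 ≤ m) (a c : ℝ) (ha : a = 1 / k) (hc : c = 1 / m)
    (g I : ℝ) (hg : |g - (1 + (c - (a+c)/2) + (c^2/2 + 1/3*(a^2-c^2) + (c - (a+c)/2)^2/2))| ≤ 64 * a^3)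
    (hI : |I - (1 + (c/2 - (a+c)/6) + (c^2/6 + (a^2-c^2)/12 + (c^2/3 - c*(a+c)/4 + (a+c)^2/20)/2))| ≤ 64 * a^3) :
    |bzZeta k m - g * bzZeta (k+1) (m-1) - (1 - I)| ≤ 400 * a^3 := by
  have ha0 : 0 < a := by rw [ha]; positivity
  have hc0 : 0 < c := by rw [hc]; apply one_div_pos.2; linarith
  have hca : c ≤ a := by rw [ha, hc]; exact one_div_le_one_div_of_le (by linarith) (by linarith)
  have ha1 : a ≤ 1 := by rw [ha, div_le_one (by linarith)]; exact hk
  have hc2 : c ≤ 1/2 := by rw [hc]; exact one_div_le_one_div_of_le (by linarith) (by linarith)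
  have ek : k = 1/a := by rw [ha]; field_simp
  have em : m = 1/c := by rw [hc, one_div_one_div]
  set x := c/(a+c) with hx
  set u := a*c/(a+c) with hu
  have hx0 : 0 < x := by positivity
  have hx1 : x ≤ 1 := by rw [hx, div_le_one (by positivity)]; linarith
  have hua : u = a * x := by rw [hu, hx]; ring
  have hu0 : 0 < u := by positivity
  have hu1 : u ≤ a := by rw [hua]; nlinarith
  set r := a^3/(1+a) with hr
  set q := c^3/(1-c) with hq
  have hr0 : 0 ≤ r := by positivity
  have hr1 : r ≤ a^3 := by
    rw [hr, div_le_iff₀ (by positivity)]; nlinarith [pow_pos ha0 4]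
  have hq0 : 0 ≤ q := by rw [hq]; apply div_nonneg (by positivity); linarith
  have c3 : c^3 ≤ a^3 := pow_le_pow_left₀ hc0.le hca 3
  have hq1 : q ≤ 2 * a^3 := by
    rw [hq, div_le_iff₀ (by linarith)]; nlinarith [pow_pos ha0 3, pow_pos hc0 3]
  have z0 : bzZeta k m = (1+x)/3 + 4/135*(a-c) + 2/135*((1-2*x)*u) := by
    unfold bzZeta
    rw [ek, em, hx, hu]; field_simp; ring
  have z1 : bzZeta (k+1) (m-1) = (1+x)/3 + (u/3 + 4/135*(a-c) + 2/135*((1-2*x)*u)) + (4/135*(-a^2-c^2) - 4/135*u^2) + 4/135*(r-q) := by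
    have i1 : 1/(k+1) = a - a^2 + r := by rw [ek, hr]; field_simp; ring
    have i2 : 1/(m-1) = c + c^2 + q := by
      have : (1:ℝ) - c ≠ 0 := by linarith
      have h2 : m - 1 = (1-c)/c := by rw [em]; field_simp
      rw [h2, hq]; field_simp; ring
    have i3 : k+1+(m-1) = (a+c)/(a*c) := by rw [ek, em]; field_simp; ring
    unfold bzZeta
    rw [i1, i2, i3]
    have i4 : (k+1)/((a+c)/(a*c)) = x + u := by rw [ek, hx, hu]; field_simp
    have i5 : (m-1-(k+1))/((a+c)/(a*c))^2 = (1-2*x-2*u)*u := by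
      rw [ek, em, hx, hu]; field_simp; ring
    rw [i4, i5]; ring
  set Z1 := u/3 + 4/135*(a-c) + 2/135*((1-2*x)*u) with hZ1
  set Z2 := 4/135*(-a^2-c^2) - 4/135*u^2 with hZ2
  set Z3 := 4/135*(r-q) with hZ3
  set G1 := c - (a+c)/2 with hG1
  set G2 := c^2/2 + 1/3*(a^2-c^2) + G1^2/2 with hG2
  set J1 := c/2 - (a+c)/6 with hJ1
  set J2 := c^2/6 + (a^2-c^2)/12 + (c^2/3 - c*(a+c)/4 + (a+c)^2/20)/2 with hJ2
  have c2 : c^2 ≤ a^2 := pow_le_pow_left₀ hc0.le hca 2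
  have u2 : u^2 ≤ a^2 := pow_le_pow_left₀ hu0.le hu1 2
  have a2 : a^2 ≤ a := pow_le_of_le_one ha0.le ha1 (by norm_num)
  have a3 : a^3 ≤ a^2 := pow_le_pow_of_le_one ha0.le ha1 (by norm_num)
  have a30 := pow_pos ha0 3
  have hxu : |(1-2*x)*u| ≤ a := by
    have t1 : x*u ≤ u := mul_le_of_le_one_left hu0.le hx1
    have t2 : 0 < x*u := by positivity
    rw [abs_le]; constructor <;> linarith
  have bG1 : |G1| ≤ a := by rw [abs_le]; constructor <;> linarith
  have bG1s : G1^2 ≤ a^2 := by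
    rw [← sq_abs]; exact pow_le_pow_left₀ (abs_nonneg _) bG1 2
  have bG2 : |G2| ≤ 2*a^2 := by
    have t1 := sq_nonneg G1
    have t2 := sq_nonneg c
    rw [abs_le]; constructor <;> linarith
  have bZ1 : |Z1| ≤ a := by
    rw [abs_le] at hxu ⊢; constructor <;> linarith
  have bZ2 : |Z2| ≤ a^2 := by
    have t1 := sq_nonneg u
    have t2 := sq_nonneg c
    have t3 := sq_nonneg a
    rw [abs_le]; constructor <;> linarith
  have bZ3 : |Z3| ≤ a^3 := by
    rw [abs_le]; constructor <;> linarith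
  have bz : |bzZeta (k+1) (m-1)| ≤ 2 + 2 := by
    rw [z1]
    rw [abs_le] at bZ1 bZ2 bZ3 ⊢; constructor <;> linarith
  have v1 : -((1+x)/3) * G1 - u/3 + J1 = 0 := by
    rw [hG1, hJ1, hx, hu]; field_simp; ring
  have v2 : -((1+x)/3) * G2 - G1*Z1 - Z2 + J2 = 0 := by
    rw [hG2, hZ1, hZ2, hJ2, hG1, hx, hu]; field_simp; ring
  have key : bzZeta k m - g * bzZeta (k+1) (m-1) - (1 - I) =
      -(g - (1+G1+G2)) * bzZeta (k+1) (m-1) + (I - (1+J1+J2)) - (Z3 + G1*Z2 + G1*Z3 + G2*Z1 + G2*Z2 + G2*Z3) := by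
    rw [z0, z1]
    linear_combination v1 + v2 + 0 * hZ1
  have w1 : |(g - (1+G1+G2)) * bzZeta (k+1) (m-1)| ≤ 256*a^3 := by
    rw [abs_mul]
    calc _ ≤ (64*a^3)*(2+2) := mul_le_mul hg bz (abs_nonneg _) (by positivity)
      _ = _ := by ring
  have mm : ∀ p q α β : ℝ, |p| ≤ α → |q| ≤ β → |p*q| ≤ α*β := fun p q α β h1 h2 => by
    rw [abs_mul]; exact mul_le_mul h1 h2 (abs_nonneg _) ((abs_nonneg _).trans h1)
  have y1 := mm _ _ _ _ bG1 bZ2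
  have y2 := mm _ _ _ _ bG1 bZ3
  have y3 := mm _ _ _ _ bG2 bZ1
  have y4 := mm _ _ _ _ bG2 bZ2
  have y5 := mm _ _ _ _ bG2 bZ3
  have a4 : a^4 ≤ a^3 := pow_le_pow_of_le_one ha0.le ha1 (by norm_num)
  have a5 : a^5 ≤ a^4 := pow_le_pow_of_le_one ha0.le ha1 (by norm_num)
  rw [key]
  rw [show a * a^2 = a^3 by ring] at y1
  rw [show a * a^3 = a^4 by ring] at y2
  rw [show 2 * a^2 * a = 2 * a^3 by ring] at y3
  rw [show 2 * a^2 * a^2 = 2 * a^4 by ring] at y4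
  rw [show 2 * a^2 * a^3 = 2 * a^5 by ring] at y5
  rw [abs_le] at w1 hI bZ3 y1 y2 y3 y4 y5 ⊢
  rw [neg_mul]
  constructor <;> linarith

lemma bz_err_step (k m : ℕ) (hk : 1 ≤ k) (hkm : k ≤ m) :
    |(binZ k (k+(m+1)) - bzZeta k (m+1)) - bzG k (m+1) 1 * (binZ (k+1) (k+(m+1)) - bzZeta (k+1) m)| ≤ 400 / (k:ℝ)^3 := by
  have hk' : (1:ℝ) ≤ k := by exact_mod_cast hk
  have hm' : (k:ℝ) ≤ m := by exact_mod_cast hkm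
  have h1 := bz_step_s16 k m (by omega) (by omega)
  have h2 := bzG_est k (m+1) hk (by omega) 1 zero_le_one le_rfl _ _ rfl rfl
  have h3 := bzI_est k (m+1) hk (by omega) _ _ rfl rfl
  have h4 := bzZeta_step k ((m+1 : ℕ):ℝ) hk' (by push_cast; linarith) _ _ rfl rfl (bzG k (m+1) 1)
    (bzH k (m+1) 0 - bzH k (m+1) 1) (by simpa using h2) h3
  rw [← h1] at h4
  have e : (400:ℝ) / (k:ℝ)^3 = 400 * (1/k)^3 := by field_simp
  rw [e, ← abs_neg]
  refine le_trans (le_of_eq ?_) h4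
  push_cast
  rw [show (m:ℝ) + 1 - 1 = m by ring]
  congr 1; ring

lemma bzG_nonneg (k m : ℕ) : 0 ≤ bzG k (m+1) 1 := by
  unfold bzG
  push_cast
  have : (0:ℝ) ≤ 1 - 1/(m+1) := by
    rw [sub_nonneg, div_le_one (by positivity)]; linarith [(Nat.cast_nonneg m : (0:ℝ) ≤ m)]
  positivity

lemma bz_err (d : ℕ) : ∀ k m : ℕ, 1 ≤ k → m = k + d →
    |binZ k (k+m) - bzZeta k m| ≤ 800 / (k:ℝ)^2 := by
  induction d using Nat.strong_induction_on with
  | _ d ih =>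
    intro k m hk hm
    have hk' : (1:ℝ) ≤ k := by exact_mod_cast hk
    rcases d with _ | _ | d
    · have hm : m = k := hm
      rw [hm]
      have h1 := bz_symm_s16 k k (by omega) (by omega)
      have h2 := bzZeta_symm k k (by linarith) (by linarith)
      have : binZ k (k+k) - bzZeta k k = 0 := by linarith
      rw [this, abs_zero]; positivity
    · have hm : m = k + 1 := hm
      subst hm
      have h1 := bz_symm_s16 k (k+1) (by omega) (by omega)
      have h2 := bzZeta_symm k (k+1) (by linarith) (by linarith)
      have h3 := bz_err_step k k hk le_rfl
      have h4 := bzG_nonneg k k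
      have e : binZ (k+1) (k+(k+1)) - bzZeta (k+1) k = -(binZ k (k+(k+1)) - bzZeta k (k+1)) := by linarith
      rw [e] at h3
      push_cast
      set E := binZ k (k+(k+1)) - bzZeta k (k+1)
      have e2 : E - bzG k (k+1) 1 * -E = (1 + bzG k (k+1) 1) * E := by ring
      rw [e2, abs_mul, abs_of_nonneg (by linarith)] at h3
      have h5 : (400:ℝ) / (k:ℝ)^3 ≤ 800 / (k:ℝ)^2 := by
        rw [div_le_div_iff₀ (by positivity) (by positivity)]
        nlinarith [sq_nonneg (k:ℝ), mul_nonneg (sq_nonneg (k:ℝ)) (by linarith : (0:ℝ) ≤ k - 1)]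
      nlinarith [abs_nonneg E]
    · obtain ⟨j, rfl⟩ : ∃ j, m = j + 1 := ⟨m - 1, by omega⟩
      have h0 := ih d (by omega) (k+1) j (by omega) (by omega)
      rw [show k + 1 + j = k + (j+1) by ring] at h0
      have h3 := bz_err_step k j hk (by omega)
      have h4 := bzG_nonneg k j
      have h5 := bzG_le_one k j hk (by omega)
      push_cast at h0 ⊢
      set E := binZ k (k+(j+1)) - bzZeta k (j+1)
      set E' := binZ (k+1) (k+(j+1)) - bzZeta (k+1) j
      have h6 : |E| ≤ |E'| + 400/(k:ℝ)^3 := by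
        have : |bzG k (j+1) 1 * E'| ≤ |E'| := by
          rw [abs_mul, abs_of_nonneg h4]; nlinarith [abs_nonneg E']
        have t := abs_sub_abs_le_abs_sub E (bzG k (j+1) 1 * E')
        linarith
      have h7 : 800/((k:ℝ)+1)^2 + 400/(k:ℝ)^3 ≤ 800/(k:ℝ)^2 := by
        rw [div_add_div _ _ (by positivity) (by positivity), div_le_div_iff₀ (by positivity) (by positivity)]
        have : 800/(k:ℝ)^2 = 800/(k:ℝ)^2 := rfl
        have hx : 0 ≤ (k:ℝ)^2 * (3*(k:ℝ)^2 - 1) := by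
          apply mul_nonneg (sq_nonneg _); nlinarith
        nlinarith
      linarith

theorem z_asymptotic_expansion (C : ℝ) (hC : 0 < C) :
    ∃ K : ℝ, 0 < K ∧ ∀ b n : ℕ, 0 < b → C * (b : ℝ) ^ 2 < (n : ℝ) →
      |binZ b n - (1 / 3 + 4 / (135 * (b : ℝ)) + (b : ℝ) / (3 * (n : ℝ)))| ≤
        K / ((b : ℝ) * Real.sqrt (b : ℝ)) := by
  obtain ⟨N, hN⟩ := exists_nat_gt (4 / C)
  let f : ℕ → ℕ → ℝ := fun b n => |binZ b n - (1 / 3 + 4 / (135 * (b : ℝ)) + (b : ℝ) / (3 * (n : ℝ)))| * ((b : ℝ) * Real.sqrt (b : ℝ))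
  have hf : ∀ b n, 0 ≤ f b n := fun b n => by positivity
  let S : ℝ := ∑ b ∈ Finset.range N, ∑ n ∈ Finset.range N, f b n
  have hS : 0 ≤ S := Finset.sum_nonneg fun b _ => Finset.sum_nonneg fun n _ => hf b n
  refine ⟨S + (800 + 1/C), by positivity, ?_⟩
  intro b n hb hn
  have hb' : (1:ℝ) ≤ b := by exact_mod_cast hb
  have hsq : 0 < (b : ℝ) * Real.sqrt (b : ℝ) := by positivity
  rw [le_div_iff₀ hsq]
  change f b n ≤ _
  by_cases h : 2 * b ≤ n
  · obtain ⟨d, rfl⟩ : ∃ d, n = b + (b + d) := ⟨n - 2 * b, by omega⟩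
    have h1 := bz_err d b (b+d) hb rfl
    set m := b + d with hm
    have hm' : (b:ℝ) ≤ m := by exact_mod_cast (by omega : b ≤ m)
    have hmb : (0:ℝ) < b + m := by linarith
    push_cast at hn
    have h2 : |bzZeta b m - (1 / 3 + 4 / (135 * (b : ℝ)) + (b : ℝ) / (3 * ((b + m : ℕ) : ℝ)))| ≤ 1/((b:ℝ)+m) := by
      have e : bzZeta b m - (1 / 3 + 4 / (135 * (b : ℝ)) + (b : ℝ) / (3 * ((b + m : ℕ) : ℝ))) =
        2/135*((m-b)/(b+m)^2) - 4/135*(1/m) := by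
        unfold bzZeta; push_cast; field_simp; ring
      rw [e]
      have t1 : 1/(m:ℝ) ≤ 2 * (1/(b+m)) := by
        rw [mul_one_div, div_le_div_iff₀ (by linarith) hmb]; linarith
      have t2 : ((m:ℝ)-b)/(b+m)^2 ≤ 1/(b+m) := by
        rw [div_le_div_iff₀ (by positivity) hmb]; nlinarith
      have t3 : 0 ≤ ((m:ℝ)-b)/(b+m)^2 := div_nonneg (by linarith) (by positivity)
      have t4 : 0 ≤ 1/(m:ℝ) := by positivity
      rw [abs_le]; constructor <;> linarith
    have h3 : 1/((b:ℝ)+m) ≤ (1/C) / (b:ℝ)^2 := by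
      rw [div_div]
      exact one_div_le_one_div_of_le (by positivity) hn.le
    have h4 : |binZ b (b+m) - (1 / 3 + 4 / (135 * (b : ℝ)) + (b : ℝ) / (3 * ((b + m : ℕ) : ℝ)))| ≤ (800 + 1/C)/(b:ℝ)^2 := by
      rw [add_div]
      have := abs_add_le (binZ b (b+m) - bzZeta b m) (bzZeta b m - (1 / 3 + 4 / (135 * (b : ℝ)) + (b : ℝ) / (3 * ((b + m : ℕ) : ℝ))))
      rw [sub_add_sub_cancel] at this
      linarith
    have h5 : Real.sqrt b ≤ b := by
      rw [Real.sqrt_le_left (by linarith)]; nlinarith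
    have h6 : f b (b+m) ≤ (800 + 1/C)/(b:ℝ)^2 * (b*b) :=
      mul_le_mul h4 (by gcongr) hsq.le (by positivity)
    have h7 : (800 + 1/C)/(b:ℝ)^2 * (b*b) = 800 + 1/C := by field_simp
    linarith
  · have hnb : (n:ℝ) < 2 * b := by exact_mod_cast (by omega : n < 2 * b)
    have hCb : C * b < 2 := by
      by_contra hcon
      push Not at hcon
      nlinarith
    have hb2 : (b:ℝ) < 2 / C := by rw [lt_div_iff₀ hC]; linarith
    have e4 : 4 / C = 2 * (2 / C) := by ring
    have hbN : b < N := by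
      have : (b:ℝ) < N := by linarith
      exact_mod_cast this
    have hnN : n < N := by
      have : (n:ℝ) < N := by linarith
      exact_mod_cast this
    have t1 : f b n ≤ ∑ n ∈ Finset.range N, f b n :=
      Finset.single_le_sum (f := fun n => f b n) (fun n _ => hf b n) (Finset.mem_range.2 hnN)
    have t2 : ∑ n ∈ Finset.range N, f b n ≤ S :=
      Finset.single_le_sum (f := fun b => ∑ n ∈ Finset.range N, f b n)
        (fun b _ => Finset.sum_nonneg fun n _ => hf b n) (Finset.mem_range.2 hbN)
    have : 0 < 1 / C := by positivity
    linarith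
end
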